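/- arXiv:1709.06037 — 2 statements merged into one kernel-verified Lean document; each statement's English description precedes it below -/
import Mathlib

section
/- Let α ∈ (0,2), s > 0, R > 0 and d ≥ 1, and suppose that d ≥ 2 or α ∈ (1,2). Let B_R(0) = {x ∈ ℝ^d : ‖x‖ ≤ R}. Then there exist a symmetric positive semidefinite kernel C : B_R(0) × B_R(0) → ℝ with C(x,x) − 2 C(x,y) + C(y,y) = ‖(x − y)/s‖^α for all x, y ∈ B_R(0), and a constant c < (A_{α,d}/2)(R/s)^α such that C(x,x) ≤ c for all x ∈ B_R(0), where A_{α,d} = Γ((2−α)/2) Γ((d+α)/2) / Γ(d/2). In other words, the minimal K-stationary representation does not minimize the maximal variance among all Gaussian representations of the variogram γ(h) = ‖h/s‖^α on B_R(0) unless d = 1 and α ∈ (0,1]. -/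
section KernelConstruction

open MeasureTheory Set

theorem Gamma_mul_le {a b c e : ℝ} (ha : 0 < a) (hc : a < c) (he : a < e)
    (h : c + e = a + b) : Real.Gamma c * Real.Gamma e ≤ Real.Gamma a * Real.Gamma b := by
  have hb : 0 < b := by linarith
  have hab : 0 < b - a := by linarith
  have key := Real.convexOn_log_Gamma.2 (show a ∈ Ioi (0:ℝ) from ha) (show b ∈ Ioi (0:ℝ) from hb)
  have h1 := key (a := (b - c) / (b - a)) (b := (c - a) / (b - a))
    (div_nonneg (by linarith) hab.le) (div_nonneg (by linarith) hab.le) (by field_simp; ring)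
  have h2 := key (a := (b - e) / (b - a)) (b := (e - a) / (b - a))
    (div_nonneg (by linarith) hab.le) (div_nonneg (by linarith) hab.le) (by field_simp; ring)
  have e1 : ((b - c) / (b - a)) • a + ((c - a) / (b - a)) • b = c := by
    simp only [smul_eq_mul]; field_simp; ring
  have e2 : ((b - e) / (b - a)) • a + ((e - a) / (b - a)) • b = e := by
    simp only [smul_eq_mul]; field_simp; ring
  rw [e1] at h1
  rw [e2] at h2
  simp only [Function.comp_apply, smul_eq_mul] at h1 h2
  have hsum1 : (b - c) / (b - a) + (b - e) / (b - a) = 1 := by field_simp; linarith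
  have hsum2 : (c - a) / (b - a) + (e - a) / (b - a) = 1 := by field_simp; linarith
  have hGa := Real.Gamma_pos_of_pos ha
  have hGb := Real.Gamma_pos_of_pos hb
  have hGc := Real.Gamma_pos_of_pos (ha.trans hc)
  have hGe := Real.Gamma_pos_of_pos (ha.trans he)
  rw [← Real.log_le_log_iff (by positivity) (by positivity), Real.log_mul hGc.ne' hGe.ne',
    Real.log_mul hGa.ne' hGb.ne']
  calc _ ≤ _ := add_le_add h1 h2
    _ = ((b - c) / (b - a) + (b - e) / (b - a)) * Real.log (Real.Gamma a)
        + ((c - a) / (b - a) + (e - a) / (b - a)) * Real.log (Real.Gamma b) := by ring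
    _ = _ := by rw [hsum1, hsum2, one_mul, one_mul]

theorem Gamma_mul_lt {a b c e : ℝ} (ha : 0 < a) (hc : a < c) (he : a < e)
    (h : c + e = a + b) : Real.Gamma c * Real.Gamma e < Real.Gamma a * Real.Gamma b := by
  have hb : 0 < b := by linarith
  have hc0 := ha.trans hc
  have he0 := ha.trans he
  have h1 := Gamma_mul_le (a := a + 1) (b := b + 1) (c := c + 1) (e := e + 1)
    (by linarith) (by linarith) (by linarith) (by linarith)
  rw [Real.Gamma_add_one ha.ne', Real.Gamma_add_one hb.ne', Real.Gamma_add_one hc0.ne',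
    Real.Gamma_add_one he0.ne'] at h1
  have hlt : a * b < c * e := by nlinarith [mul_pos (sub_pos.2 hc) (sub_pos.2 he)]
  have hP := mul_pos (Real.Gamma_pos_of_pos hc0) (Real.Gamma_pos_of_pos he0)
  have hab := mul_pos ha hb
  have h2 : a * b * (Real.Gamma c * Real.Gamma e) < a * b * (Real.Gamma a * Real.Gamma b) := by
    nlinarith [mul_pos (sub_pos.2 hlt) hP]
  exact lt_of_mul_lt_mul_left h2 hab.le

theorem integrableOn_rpow_mul_one_sub_cos {α : ℝ} (h0 : 0 < α) (h2 : α < 2) (x : ℝ) :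
    IntegrableOn (fun ω : ℝ => ω ^ (-1 - α) * (2 - 2 * Real.cos (ω * x))) (Ioi 0) := by
  have hm : Measurable (fun ω : ℝ => ω ^ (-1 - α) * (2 - 2 * Real.cos (ω * x))) := by fun_prop
  rw [← Ioc_union_Ioi_eq_Ioi zero_le_one]
  refine IntegrableOn.union ?_ ?_
  · have hi : IntegrableOn (fun ω : ℝ => x ^ 2 * ω ^ (1 - α)) (Ioc 0 1) := by
      rw [← intervalIntegrable_iff_integrableOn_Ioc_of_le zero_le_one]
      exact (intervalIntegral.intervalIntegrable_rpow' (by linarith)).const_mul _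
    refine Integrable.mono' hi hm.aestronglyMeasurable ?_
    refine (ae_restrict_iff' measurableSet_Ioc).2 (ae_of_all _ fun ω hω => ?_)
    have hω0 : 0 < ω := hω.1
    have hc := Real.one_sub_sq_div_two_le_cos (x := ω * x)
    have hc' := Real.cos_le_one (ω * x)
    rw [Real.norm_of_nonneg (mul_nonneg (by positivity) (by linarith))]
    have : ω ^ (1 - α) = ω ^ (-1 - α) * ω ^ 2 := by
      rw [← Real.rpow_natCast, ← Real.rpow_add hω0]; norm_num; ring_nf
    rw [this]
    have hp : 0 < ω ^ (-1 - α) := by positivity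
    nlinarith
  · have hi : IntegrableOn (fun ω : ℝ => 4 * ω ^ (-1 - α)) (Ioi 1) :=
      (integrableOn_Ioi_rpow_of_lt (by linarith) one_pos).const_mul _
    refine Integrable.mono' hi hm.aestronglyMeasurable ?_
    refine (ae_restrict_iff' measurableSet_Ioi).2 (ae_of_all _ fun ω hω => ?_)
    have hω0 : 0 < ω := lt_trans one_pos hω
    have hc := Real.neg_one_le_cos (ω * x)
    have hc' := Real.cos_le_one (ω * x)
    rw [Real.norm_of_nonneg (mul_nonneg (by positivity) (by linarith))]
    have hp : 0 < ω ^ (-1 - α) := by positivity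
    nlinarith

theorem integral_rpow_mul_one_sub_cos {α : ℝ} (h0 : 0 < α) (x : ℝ) :
    ∫ ω in Ioi (0:ℝ), ω ^ (-1 - α) * (2 - 2 * Real.cos (ω * x))
      = |x| ^ α * ∫ ω in Ioi (0:ℝ), ω ^ (-1 - α) * (2 - 2 * Real.cos ω) := by
  rcases eq_or_ne x 0 with rfl | hx
  · simp [Real.zero_rpow h0.ne']
  have hx' : 0 < |x| := abs_pos.2 hx
  have := integral_comp_mul_left_Ioi
    (fun ω : ℝ => ω ^ (-1 - α) * (2 - 2 * Real.cos ω)) 0 hx'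
  rw [mul_zero] at this
  have hE : ∫ ω in Ioi (0:ℝ), ω ^ (-1 - α) * (2 - 2 * Real.cos (ω * x)) =
      |x| ^ (1 + α) * ∫ ω in Ioi (0:ℝ), (|x| * ω) ^ (-1 - α) * (2 - 2 * Real.cos (|x| * ω)) := by
    rw [← integral_const_mul]
    refine setIntegral_congr_fun measurableSet_Ioi fun ω hω => ?_
    have hω0 : (0:ℝ) < ω := hω
    have hcos : Real.cos (|x| * ω) = Real.cos (ω * x) := by
      rw [← Real.cos_abs (ω * x), abs_mul, abs_of_pos hω0, mul_comm]
    have hone : |x| ^ (1 + α) * |x| ^ (-1 - α) = 1 := by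
      rw [← Real.rpow_add hx']; ring_nf; simp
    simp only [hcos]
    rw [Real.mul_rpow hx'.le hω0.le]
    linear_combination (-(ω ^ (-1 - α) * (2 - 2 * Real.cos (ω * x)))) * hone
  rw [hE, this, smul_eq_mul, ← mul_assoc, Real.rpow_add hx', Real.rpow_one,
    mul_right_comm |x|, mul_inv_cancel₀ hx'.ne', one_mul]

theorem integral_rpow_mul_one_sub_cos_pos {α : ℝ} (h0 : 0 < α) (h2 : α < 2) :
    0 < ∫ ω in Ioi (0:ℝ), ω ^ (-1 - α) * (2 - 2 * Real.cos ω) := by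
  have hi := integrableOn_rpow_mul_one_sub_cos h0 h2 1
  simp only [mul_one] at hi
  have hnn : ∀ ω ∈ Ioi (0:ℝ), 0 ≤ ω ^ (-1 - α) * (2 - 2 * Real.cos ω) := fun ω hω =>
    mul_nonneg (Real.rpow_nonneg (le_of_lt hω) _) (by linarith [Real.cos_le_one ω])
  rw [setIntegral_pos_iff_support_of_nonneg_ae
    ((ae_restrict_iff' measurableSet_Ioi).2 (ae_of_all _ hnn)) hi]
  refine lt_of_lt_of_le ?_ (measure_mono (show Ioo (0:ℝ) 1 ⊆ _ from ?_))
  · simp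
  · rintro ω ⟨hω0, hω1⟩
    refine ⟨?_, hω0⟩
    have hlt : Real.cos ω < 1 := by
      rw [← Real.cos_zero]
      exact Real.cos_lt_cos_of_nonneg_of_le_pi_div_two le_rfl
        (by linarith [Real.pi_gt_three]) hω0
    exact (mul_pos (Real.rpow_pos_of_pos hω0 _) (by linarith)).ne'

theorem normSq_exp_mul_I_sub (a b : ℝ) :
    ‖Complex.exp (a * Complex.I) - Complex.exp (b * Complex.I)‖ ^ 2
      = 2 - 2 * Real.cos (a - b) := by
  rw [← Complex.normSq_eq_norm_sq, Complex.normSq_apply, Real.cos_sub]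
  simp only [Complex.sub_re, Complex.sub_im, Complex.exp_ofReal_mul_I_re,
    Complex.exp_ofReal_mul_I_im]
  nlinarith [Real.sin_sq_add_cos_sq a, Real.sin_sq_add_cos_sq b]

theorem exists_norm_sub_sq_eq_abs_rpow {α : ℝ} (h0 : 0 < α) (h2 : α < 2) :
    ∃ φ : ℝ → Lp ℂ 2 (volume.restrict (Ioi (0:ℝ))),
      ∀ x y, ‖φ x - φ y‖ ^ 2 = |x - y| ^ α := by
  set K := ∫ ω in Ioi (0:ℝ), ω ^ (-1 - α) * (2 - 2 * Real.cos ω) with hK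
  have hKpos : 0 < K := integral_rpow_mul_one_sub_cos_pos h0 h2
  set f : ℝ → ℝ → ℂ := fun x ω =>
    ((ω ^ ((-1 - α) / 2) : ℝ) : ℂ) * (Complex.exp ((ω * x : ℝ) * Complex.I) - 1) with hf
  have hsub : ∀ x y, ∀ ω ∈ Ioi (0:ℝ), ‖f x ω - f y ω‖ ^ 2 =
      ω ^ (-1 - α) * (2 - 2 * Real.cos (ω * (x - y))) := by
    intro x y ω hω
    have hω0 : (0:ℝ) < ω := hω
    have : f x ω - f y ω = ((ω ^ ((-1 - α) / 2) : ℝ) : ℂ) *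
        (Complex.exp ((ω * x : ℝ) * Complex.I) - Complex.exp ((ω * y : ℝ) * Complex.I)) := by
      simp only [hf]; ring
    rw [this, norm_mul, mul_pow, normSq_exp_mul_I_sub, Complex.norm_real,
      Real.norm_of_nonneg (by positivity), ← Real.rpow_natCast, ← Real.rpow_mul hω0.le]
    congr 2
    · push_cast; ring
    · ring_nf
  have hmeas : ∀ x, Measurable (f x) := fun x => by simp only [hf]; fun_prop
  have hz : f 0 = fun _ => 0 := by funext ω; simp [hf]
  have hmem : ∀ x, MemLp (f x) 2 (volume.restrict (Ioi (0:ℝ))) := by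
    intro x
    rw [memLp_two_iff_integrable_sq_norm (hmeas x).aestronglyMeasurable]
    refine (integrableOn_congr_fun ?_ measurableSet_Ioi).2
      (integrableOn_rpow_mul_one_sub_cos h0 h2 x)
    intro ω hω
    have := hsub x 0 ω hω
    simpa [hz] using this
  refine ⟨fun x => (Real.sqrt K)⁻¹ • (hmem x).toLp (f x), fun x y => ?_⟩
  rw [← smul_sub, norm_smul, mul_pow, norm_inv, Real.norm_of_nonneg (Real.sqrt_nonneg _),
    inv_pow, Real.sq_sqrt hKpos.le, ← MemLp.toLp_sub, ← real_inner_self_eq_norm_sq, L2.inner_def]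
  have : ∫ ω in Ioi (0:ℝ), inner ℝ ((((hmem x).sub (hmem y)).toLp (f x - f y) :
      Lp ℂ 2 (volume.restrict (Ioi (0:ℝ)))) ω) ((((hmem x).sub (hmem y)).toLp (f x - f y) :
      Lp ℂ 2 (volume.restrict (Ioi (0:ℝ)))) ω)
      = ∫ ω in Ioi (0:ℝ), ω ^ (-1 - α) * (2 - 2 * Real.cos (ω * (x - y))) := by
    refine integral_congr_ae ?_
    filter_upwards [MemLp.coeFn_toLp ((hmem x).sub (hmem y)),
      ae_restrict_mem measurableSet_Ioi] with ω h1 h2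
    rw [h1, real_inner_self_eq_norm_sq, Pi.sub_apply, hsub x y ω h2]
  rw [this, integral_rpow_mul_one_sub_cos h0, ← hK]
  field_simp

theorem integral_rpow_mul_one_add_sq_rpow {p q : ℝ} (hp : -1 < p) (hq : (p + 1) / 2 < q) :
    ∫ τ in Ioi (0:ℝ), τ ^ p * (1 + τ ^ 2) ^ (-q)
      = Real.Gamma ((p + 1) / 2) * Real.Gamma (q - (p + 1) / 2) / (2 * Real.Gamma q) := by
  have hq0 : 0 < q := by linarith
  have hGq := Real.Gamma_pos_of_pos hq0
  set F : ℝ → ℝ → ℝ := fun t τ => t ^ (q - 1) * Real.exp (-t) * (τ ^ p * Real.exp (-t * τ ^ (2:ℝ)))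
    with hF
  have hin1 : ∀ t ∈ Ioi (0:ℝ), ∫ τ in Ioi (0:ℝ), F t τ
      = 1 / 2 * Real.Gamma ((p + 1) / 2) * (Real.exp (-t) * t ^ (q - (p + 1) / 2 - 1)) := by
    intro t ht
    have ht0 : (0:ℝ) < t := ht
    simp only [hF]
    rw [integral_const_mul, integral_rpow_mul_exp_neg_mul_rpow two_pos hp ht0]
    have : t ^ (q - (p + 1) / 2 - 1) = t ^ (q - 1) * t ^ (-(p + 1) / 2) := by
      rw [← Real.rpow_add ht0]; ring_nf
    rw [this]; ring
  have hin2 : ∀ τ ∈ Ioi (0:ℝ), ∫ t in Ioi (0:ℝ), F t τ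
      = Real.Gamma q * (τ ^ p * (1 + τ ^ 2) ^ (-q)) := by
    intro τ hτ
    have := Real.integral_rpow_mul_exp_neg_mul_Ioi hq0 (show 0 < 1 + τ ^ 2 by positivity)
    have h3 : ∀ t, F t τ = τ ^ p * (t ^ (q - 1) * Real.exp (-((1 + τ ^ 2) * t))) := by
      intro t
      simp only [hF]
      rw [show -((1 + τ ^ 2) * t) = -t + -t * τ ^ (2:ℝ) by rw [Real.rpow_two]; ring, Real.exp_add]
      ring
    simp only [h3]
    rw [integral_const_mul, this, Real.rpow_neg (by positivity), one_div,
      Real.inv_rpow (by positivity)]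
    ring
  have hint : Integrable (Function.uncurry F)
      ((volume.restrict (Ioi (0:ℝ))).prod (volume.restrict (Ioi (0:ℝ)))) := by
    rw [integrable_prod_iff (Measurable.aestronglyMeasurable (by simp only [hF]; fun_prop))]
    have hnn : ∀ t ∈ Ioi (0:ℝ), ∀ τ ∈ Ioi (0:ℝ), ‖F t τ‖ = F t τ := by
      intro t ht τ hτ
      have ht0 : (0:ℝ) < t := ht
      have hτ0 : (0:ℝ) < τ := hτ
      exact Real.norm_of_nonneg (by simp only [hF]; positivity)
    constructor
    · refine (ae_restrict_iff' measurableSet_Ioi).2 (ae_of_all _ fun t ht => ?_)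
      have ht0 : (0:ℝ) < t := ht
      simp only [Function.uncurry_apply_pair, hF]
      exact (integrableOn_rpow_mul_exp_neg_mul_rpow hp two_pos ht0).const_mul _
    · refine (integrableOn_congr_fun (g := fun t =>
        1 / 2 * Real.Gamma ((p + 1) / 2) * (Real.exp (-t) * t ^ (q - (p + 1) / 2 - 1)))
        ?_ measurableSet_Ioi).2 ?_
      · intro t ht
        simp only [Function.uncurry_apply_pair]
        rw [← hin1 t ht]
        exact setIntegral_congr_fun measurableSet_Ioi fun τ hτ => hnn t ht τ hτ
      · exact (Real.GammaIntegral_convergent (by linarith)).const_mul _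
  have hswap := integral_integral_swap hint
  rw [setIntegral_congr_fun measurableSet_Ioi hin1,
    setIntegral_congr_fun measurableSet_Ioi hin2, integral_const_mul, integral_const_mul,
    ← Real.Gamma_eq_integral (by linarith)] at hswap
  rw [eq_div_iff (by positivity)]
  linarith

/-- A symmetric real kernel that is positive semidefinite on the set `S`. -/
def IsPosSemidefKernelOn {X : Type*} (S : Set X) (C : X → X → ℝ) : Prop :=
  (∀ x ∈ S, ∀ y ∈ S, C x y = C y x) ∧
    ∀ (n : ℕ) (x : Fin n → X), (∀ i, x i ∈ S) → ∀ c : Fin n → ℝ,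
      0 ≤ ∑ i, ∑ j, c i * c j * C (x i) (x j)

theorem isPosSemidefKernelOn_inner {X H : Type*} [NormedAddCommGroup H] [InnerProductSpace ℝ H]
    (S : Set X) (ψ : X → H) : IsPosSemidefKernelOn S (fun x y => inner ℝ (ψ x) (ψ y)) := by
  refine ⟨fun x _ y _ => real_inner_comm _ _, fun n x _ c => ?_⟩
  have : ∑ i, ∑ j, c i * c j * inner ℝ (ψ (x i)) (ψ (x j))
      = inner ℝ (∑ i, c i • ψ (x i)) (∑ i, c i • ψ (x i)) := by
    rw [sum_inner]
    refine Finset.sum_congr rfl fun i _ => ?_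
    rw [inner_sum]
    refine Finset.sum_congr rfl fun j _ => ?_
    rw [real_inner_smul_left, real_inner_smul_right, mul_assoc]
  rw [this]
  exact real_inner_self_nonneg

theorem inner_sub_variogram {H : Type*} [NormedAddCommGroup H] [InnerProductSpace ℝ H]
    (a b m : H) : inner ℝ (a - m) (a - m) - 2 * inner ℝ (a - m) (b - m)
      + inner ℝ (b - m) (b - m) = ‖a - b‖ ^ 2 := by
  have : a - b = (a - m) - (b - m) := by abel
  rw [this, norm_sub_sq_real, real_inner_self_eq_norm_sq, real_inner_self_eq_norm_sq]

theorem norm_sub_midpoint_sq {H : Type*} [NormedAddCommGroup H] [InnerProductSpace ℝ H]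
    (p a b : H) : ‖p - (1 / 2 : ℝ) • (a + b)‖ ^ 2
      = (‖p - a‖ ^ 2 + ‖p - b‖ ^ 2) / 2 - ‖a - b‖ ^ 2 / 4 := by
  have h1 : p - (1 / 2 : ℝ) • (a + b) = (1 / 2 : ℝ) • ((p - a) + (p - b)) := by module
  have h2 : a - b = (p - b) - (p - a) := by abel
  rw [h1, h2, norm_smul, mul_pow, norm_add_sq_real, norm_sub_sq_real (p - b),
    real_inner_comm (p - a) (p - b)]
  norm_num
  ring

theorem continuous_of_norm_sub_sq {H : Type*} [NormedAddCommGroup H] {φ : ℝ → H} {α : ℝ}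
    (h0 : 0 < α) (hφ : ∀ x y, ‖φ x - φ y‖ ^ 2 = |x - y| ^ α) : Continuous φ := by
  rw [continuous_iff_continuousAt]
  intro x
  rw [ContinuousAt, tendsto_iff_norm_sub_tendsto_zero]
  have h : ∀ y, ‖φ y - φ x‖ = Real.sqrt (|y - x| ^ α) := fun y => by
    rw [← hφ, Real.sqrt_sq (norm_nonneg _)]
  simp only [h]
  have hc : Continuous (fun y : ℝ => Real.sqrt (|y - x| ^ α)) :=
    Real.continuous_sqrt.comp
      ((continuous_abs.comp (continuous_id.sub continuous_const)).rpow_const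
        fun _ => Or.inr h0.le)
  have := hc.tendsto x
  simpa [Real.zero_rpow h0.ne'] using this

theorem exists_kernel_anchored_at_endpoints {α : ℝ} (h1 : 1 ≤ α) (h2 : α < 2) :
    ∃ C : ℝ → ℝ → ℝ, Continuous (Function.uncurry C) ∧ IsPosSemidefKernelOn univ C ∧
      (∀ x y, C x x - 2 * C x y + C y y = |x - y| ^ α) ∧
      (∀ x ∈ Icc (-1 : ℝ) 1, C x x ≤ 2 ^ α / 4) ∧ C 0 0 = 1 - 2 ^ α / 4 := by
  have h0 : 0 < α := by linarith
  obtain ⟨φ, hφ⟩ := exists_norm_sub_sq_eq_abs_rpow h0 h2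
  have hc := continuous_of_norm_sub_sq h0 hφ
  set m := (1 / 2 : ℝ) • (φ 1 + φ (-1)) with hm
  have hV : ∀ x, inner ℝ (φ x - m) (φ x - m)
      = (|x - 1| ^ α + |x + 1| ^ α) / 2 - 2 ^ α / 4 := fun x => by
    rw [real_inner_self_eq_norm_sq, hm, norm_sub_midpoint_sq, hφ, hφ, hφ]
    norm_num
  refine ⟨fun x y => inner ℝ (φ x - m) (φ y - m), ?_, isPosSemidefKernelOn_inner _ _,
    fun x y => ?_, fun x hx => ?_, ?_⟩
  · exact ((hc.comp continuous_fst).sub continuous_const).inner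
      ((hc.comp continuous_snd).sub continuous_const)
  · rw [inner_sub_variogram, hφ]
  · have key : ∀ t : ℝ, 0 ≤ t → t ≤ 2 → t ^ α ≤ 2 ^ α * (t / 2) := fun t ht0 ht2 => by
      have : t ^ α = 2 ^ α * (t / 2) ^ α := by
        rw [← Real.mul_rpow (by norm_num) (by positivity)]; congr 1; ring
      rw [this]
      refine mul_le_mul_of_nonneg_left ?_ (by positivity)
      simpa using Real.rpow_le_rpow_of_exponent_ge' (show 0 ≤ t / 2 by positivity)
        (by linarith) zero_le_one h1
    have k1 := key |x - 1| (abs_nonneg _) (abs_le.2 ⟨by linarith [hx.1], by linarith [hx.2]⟩)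
    have k2 := key |x + 1| (abs_nonneg _) (abs_le.2 ⟨by linarith [hx.1], by linarith [hx.2]⟩)
    have e1 : |x - 1| = 1 - x := by rw [abs_sub_comm, abs_of_nonneg (by linarith [hx.2])]
    have e2 : |x + 1| = x + 1 := abs_of_nonneg (by linarith [hx.1])
    show inner ℝ (φ x - m) (φ x - m) ≤ _
    rw [hV]
    have : (2:ℝ) ^ α * (|x - 1| / 2) + 2 ^ α * (|x + 1| / 2) = 2 ^ α := by rw [e1, e2]; ring
    linarith
  · show inner ℝ (φ 0 - m) (φ 0 - m) = _
    rw [hV]; norm_num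

theorem integral_weight_mul_norm_sub_sq {Ω H : Type*} [MeasurableSpace Ω] {μ : Measure Ω}
    [NormedAddCommGroup H] [InnerProductSpace ℝ H] [CompleteSpace H] {w : Ω → ℝ} {ψ : Ω → H}
    (hw : Integrable w μ) (hw1 : ∫ ω, w ω ∂μ = 1) (hψ : AEStronglyMeasurable ψ μ) {B : ℝ}
    (hB : ∀ ω, ‖ψ ω‖ ≤ B) (p : H) :
    ∫ ω, w ω * ‖p - ψ ω‖ ^ 2 ∂μ = ‖p - ∫ ω, w ω • ψ ω ∂μ‖ ^ 2
      + ∫ ω, w ω * ‖ψ ω - ∫ ω', w ω' • ψ ω' ∂μ‖ ^ 2 ∂μ := by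
  set m := ∫ ω, w ω • ψ ω ∂μ with hm
  have hwψ : Integrable (fun ω => w ω • ψ ω) μ :=
    hw.smul_bdd B hψ (ae_of_all _ hB)
  have hwm : Integrable (fun ω => w ω • m) μ := hw.smul_const m
  have hI : Integrable (fun ω => w ω • m - w ω • ψ ω) μ := hwm.sub hwψ
  have hz : ∫ ω, (w ω • m - w ω • ψ ω) ∂μ = 0 := by
    rw [integral_sub hwm hwψ, integral_smul_const, hw1, one_smul, ← hm, sub_self]
  have hsq : Integrable (fun ω => w ω * ‖ψ ω - m‖ ^ 2) μ := by
    refine hw.mul_bdd (c := (B + ‖m‖) ^ 2) ((hψ.sub aestronglyMeasurable_const).norm.pow 2)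
      (ae_of_all _ fun ω => ?_)
    rw [norm_pow, norm_norm]
    exact pow_le_pow_left₀ (norm_nonneg _) ((norm_sub_le _ _).trans (by linarith [hB ω])) 2
  have hexp : ∀ ω, w ω * ‖p - ψ ω‖ ^ 2 = w ω * ‖p - m‖ ^ 2
      + 2 * inner ℝ (p - m) (w ω • m - w ω • ψ ω) + w ω * ‖ψ ω - m‖ ^ 2 := fun ω => by
    have : p - ψ ω = (p - m) + (m - ψ ω) := by abel
    rw [this, norm_add_sq_real, ← smul_sub, real_inner_smul_right, norm_sub_rev (ψ ω) m]
    ring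
  simp only [hexp]
  rw [integral_add _ hsq, integral_add, integral_mul_const, hw1, integral_const_mul,
    integral_inner hI, hz, inner_zero_right]
  · ring
  · exact hw.mul_const _
  · exact (hI.const_inner _).const_mul _
  · exact (hw.mul_const _).add ((hI.const_inner _).const_mul _)

theorem integral_cosh_mul_comp_sinh (G : ℝ → ℝ) :
    ∫ η, Real.cosh η * G (Real.sinh η) = ∫ τ, G τ := by
  have := integral_image_eq_integral_abs_deriv_smul (f := Real.sinh) (f' := Real.cosh)
    MeasurableSet.univ (fun x _ => (Real.hasDerivAt_sinh x).hasDerivWithinAt)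
    Real.sinh_injective.injOn G
  rw [image_univ, Real.sinh_surjective.range_eq, setIntegral_univ, setIntegral_univ] at this
  rw [this]
  simp [abs_of_pos (Real.cosh_pos _)]

theorem integrable_cosh_mul_comp_sinh {G : ℝ → ℝ} (hG : Integrable G) :
    Integrable (fun η => Real.cosh η * G (Real.sinh η)) := by
  have := integrableOn_image_iff_integrableOn_abs_deriv_smul (f := Real.sinh) (f' := Real.cosh)
    MeasurableSet.univ (fun x _ => (Real.hasDerivAt_sinh x).hasDerivWithinAt)
    Real.sinh_injective.injOn G
  rw [image_univ, Real.sinh_surjective.range_eq, integrableOn_univ, integrableOn_univ] at this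
  simpa [abs_of_pos (Real.cosh_pos _)] using this.1 hG

theorem cosh_rpow_sub_one_eq (α η : ℝ) : Real.cosh η ^ (α - 1)
    = Real.cosh η * (1 + Real.sinh η ^ 2) ^ (-((2 - α) / 2)) := by
  have hc := Real.cosh_pos η
  have : 1 + Real.sinh η ^ 2 = Real.cosh η ^ (2:ℝ) := by
    rw [Real.rpow_two, Real.cosh_sq]; ring
  rw [this, ← Real.rpow_mul hc.le, mul_comm, ← Real.rpow_add_one hc.ne']
  congr 1; ring

theorem integrable_cosh_rpow_sub_one {α : ℝ} (h1 : α < 1) :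
    Integrable (fun η : ℝ => Real.cosh η ^ (α - 1)) := by
  simp only [cosh_rpow_sub_one_eq]
  refine integrable_cosh_mul_comp_sinh (G := fun τ => (1 + τ ^ 2) ^ (-((2 - α) / 2))) ?_
  have := integrable_rpow_neg_one_add_norm_sq (E := ℝ) (μ := volume) (r := 2 - α)
    (by simp; linarith)
  simpa only [neg_div, Real.norm_eq_abs, sq_abs] using this

theorem integral_cosh_rpow_sub_one {α : ℝ} (h1 : α < 1) :
    ∫ η : ℝ, Real.cosh η ^ (α - 1)
      = Real.sqrt Real.pi * Real.Gamma ((1 - α) / 2) / Real.Gamma ((2 - α) / 2) := by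
  simp only [cosh_rpow_sub_one_eq]
  rw [integral_cosh_mul_comp_sinh (fun τ => (1 + τ ^ 2) ^ (-((2 - α) / 2)))]
  have := integral_rpow_mul_one_add_sq_rpow (p := 0) (q := (2 - α) / 2) (by norm_num)
    (by linarith)
  have h := integral_comp_abs (f := fun τ : ℝ => (1 + τ ^ 2) ^ (-((2 - α) / 2)))
  simp only [sq_abs] at h
  rw [h]
  simp only [Real.rpow_zero, one_mul, zero_add, Real.Gamma_one_half_eq] at this
  rw [this, show (2 - α) / 2 - 1 / 2 = (1 - α) / 2 by ring]
  ring

theorem integral_abs_rpow_mul_inv_one_add_sq {α : ℝ} (h0 : 0 < α) (h1 : α < 1) :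
    ∫ τ : ℝ, |τ| ^ α * (1 + τ ^ 2)⁻¹
      = Real.Gamma ((1 + α) / 2) * Real.Gamma ((1 - α) / 2) := by
  have := integral_rpow_mul_one_add_sq_rpow (p := α) (q := 1) (by linarith) (by linarith)
  have h := integral_comp_abs (f := fun τ : ℝ => τ ^ α * (1 + τ ^ 2)⁻¹)
  simp only [sq_abs] at h
  simp only [Real.rpow_neg_one] at this
  rw [h, this, Real.Gamma_one, show 1 - (α + 1) / 2 = (1 - α) / 2 by ring, add_comm α 1]
  ring

theorem continuous_tanh : Continuous Real.tanh := by
  have : Real.tanh = fun x => Real.sinh x / Real.cosh x :=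
      funext fun x => Real.tanh_eq_sinh_div_cosh x
  rw [this]
  exact Real.continuous_sinh.div Real.continuous_cosh fun x => (Real.cosh_pos x).ne'

theorem abs_tanh_sub_tanh (x y : ℝ) : |Real.tanh x - Real.tanh y|
    = |Real.sinh (y - x)| / (Real.cosh x * Real.cosh y) := by
  have hx := Real.cosh_pos x
  have hy := Real.cosh_pos y
  rw [abs_sub_comm, Real.tanh_eq_sinh_div_cosh, Real.tanh_eq_sinh_div_cosh,
    div_sub_div _ _ hy.ne' hx.ne', abs_div, abs_of_pos (mul_pos hy hx), Real.sinh_sub,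
    mul_comm (Real.cosh y) (Real.cosh x), mul_comm (Real.cosh y) (Real.sinh x)]

theorem integral_cosh_rpow_mul_abs_tanh_sub {α : ℝ} (h0 : 0 < α) (h1 : α < 1) (ξ : ℝ) :
    ∫ θ : ℝ, Real.cosh θ ^ (α - 1) * |Real.tanh ξ - Real.tanh θ| ^ α
      = ∫ τ : ℝ, |τ| ^ α * (1 + τ ^ 2)⁻¹ := by
  have hξ := Real.cosh_pos ξ
  have hpt : ∀ θ, Real.cosh θ ^ (α - 1) * |Real.tanh ξ - Real.tanh θ| ^ α
      = (Real.cosh ξ ^ α)⁻¹ * (|Real.sinh (θ - ξ)| ^ α / Real.cosh θ) := fun θ => by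
    have hθ := Real.cosh_pos θ
    rw [abs_tanh_sub_tanh, Real.div_rpow (abs_nonneg _) (by positivity),
      Real.mul_rpow hξ.le hθ.le, Real.rpow_sub_one hθ.ne']
    field_simp
  have hint : Integrable (fun θ : ℝ => |Real.sinh (θ - ξ)| ^ α / Real.cosh θ) := by
    have h : Integrable
        (fun θ : ℝ => Real.cosh θ ^ (α - 1) * |Real.tanh ξ - Real.tanh θ| ^ α) := by
      refine (integrable_cosh_rpow_sub_one h1).mul_bdd (c := 2 ^ α) ?_ (ae_of_all _ fun θ => ?_)
      · exact ((continuous_abs.comp (continuous_const.sub continuous_tanh)).rpow_const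
          fun _ => Or.inr h0.le).aestronglyMeasurable
      · rw [Real.norm_of_nonneg (by positivity)]
        refine Real.rpow_le_rpow (abs_nonneg _) ?_ h0.le
        have a1 := abs_lt.1 (Real.abs_tanh_lt_one ξ)
        have a2 := abs_lt.1 (Real.abs_tanh_lt_one θ)
        exact abs_le.2 ⟨by linarith, by linarith⟩
    simp only [hpt] at h
    have h' := h.const_mul (Real.cosh ξ ^ α)
    refine h'.congr (ae_of_all _ fun θ => ?_)
    have : Real.cosh ξ ^ α ≠ 0 := by positivity
    simp only
    field_simp
  simp only [hpt]
  rw [integral_const_mul]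
  set I := ∫ θ : ℝ, |Real.sinh (θ - ξ)| ^ α / Real.cosh θ with hI
  have hshift : I = ∫ η : ℝ, |Real.sinh η| ^ α / Real.cosh (η + ξ) := by
    rw [hI, ← integral_add_right_eq_self _ ξ]
    simp
  have hint1 : Integrable (fun η : ℝ => |Real.sinh η| ^ α / Real.cosh (η + ξ)) := by
    simpa using hint.comp_add_right ξ
  have hint2 : Integrable (fun η : ℝ => |Real.sinh η| ^ α / Real.cosh (η - ξ)) := by
    have := hint1.comp_neg
    refine this.congr (ae_of_all _ fun η => ?_)
    simp only [Real.sinh_neg, abs_neg]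
    rw [← Real.cosh_neg, neg_add, neg_neg, sub_eq_add_neg]
  have hneg : I = ∫ η : ℝ, |Real.sinh η| ^ α / Real.cosh (η - ξ) := by
    rw [hshift, ← integral_neg_eq_self]
    refine integral_congr_ae (ae_of_all _ fun η => ?_)
    simp only [Real.sinh_neg, abs_neg]
    rw [← Real.cosh_neg, neg_add, neg_neg, sub_eq_add_neg]
  have hsum : 2 * I = ∫ η : ℝ, 2 * Real.cosh ξ * (Real.cosh η *
      (|Real.sinh η| ^ α * (Real.cosh ξ ^ 2 + Real.sinh η ^ 2)⁻¹)) := by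
    rw [two_mul]
    nth_rewrite 1 [hshift]
    rw [hneg, ← integral_add hint1 hint2]
    refine integral_congr_ae (ae_of_all _ fun η => ?_)
    have hp : Real.cosh (η + ξ) * Real.cosh (η - ξ) = Real.cosh ξ ^ 2 + Real.sinh η ^ 2 := by
      rw [Real.cosh_add, Real.cosh_sub]
      nlinarith [Real.cosh_sq η, Real.cosh_sq ξ]
    have hs : Real.cosh (η + ξ) + Real.cosh (η - ξ) = 2 * Real.cosh η * Real.cosh ξ := by
      rw [Real.cosh_add, Real.cosh_sub]; ring
    have p1 := Real.cosh_pos (η + ξ)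
    have p2 := Real.cosh_pos (η - ξ)
    simp only
    rw [← hp, div_add_div _ _ p1.ne' p2.ne', div_eq_mul_inv]
    linear_combination (|Real.sinh η| ^ α * (Real.cosh (η + ξ) * Real.cosh (η - ξ))⁻¹) * hs
  rw [integral_const_mul,
    integral_cosh_mul_comp_sinh (fun τ => |τ| ^ α * (Real.cosh ξ ^ 2 + τ ^ 2)⁻¹)] at hsum
  have hscale := Measure.integral_comp_mul_left
    (fun τ : ℝ => |τ| ^ α * (Real.cosh ξ ^ 2 + τ ^ 2)⁻¹) (Real.cosh ξ)
  have hsc : ∀ τ : ℝ, |Real.cosh ξ * τ| ^ α * (Real.cosh ξ ^ 2 + (Real.cosh ξ * τ) ^ 2)⁻¹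
      = Real.cosh ξ ^ α * (Real.cosh ξ ^ 2)⁻¹ * (|τ| ^ α * (1 + τ ^ 2)⁻¹) := fun τ => by
    rw [abs_mul, abs_of_pos hξ, Real.mul_rpow hξ.le (abs_nonneg _),
      show Real.cosh ξ ^ 2 + (Real.cosh ξ * τ) ^ 2 = Real.cosh ξ ^ 2 * (1 + τ ^ 2) by ring, mul_inv]
    ring
  simp only [hsc] at hscale
  rw [integral_const_mul, smul_eq_mul, abs_of_pos (inv_pos.2 hξ)] at hscale
  set P := ∫ τ : ℝ, |τ| ^ α * (1 + τ ^ 2)⁻¹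
  set Q := ∫ τ : ℝ, |τ| ^ α * (Real.cosh ξ ^ 2 + τ ^ 2)⁻¹
  have hξα : 0 < Real.cosh ξ ^ α := by positivity
  have hIQ : I = Real.cosh ξ * Q := by linarith
  have hQ : Q = Real.cosh ξ ^ α * (Real.cosh ξ)⁻¹ * P := by
    field_simp at hscale ⊢
    linarith
  rw [hIQ, hQ]
  field_simp

theorem exists_stationary_kernel {α : ℝ} (h0 : 0 < α) (h1 : α < 1) :
    ∃ C : ℝ → ℝ → ℝ, Continuous (Function.uncurry C) ∧ IsPosSemidefKernelOn univ C ∧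
      (∀ x y, C x x - 2 * C x y + C y y = |x - y| ^ α) ∧
      (∀ x ∈ Icc (-1 : ℝ) 1, C x x =
        Real.Gamma ((2 - α) / 2) * Real.Gamma ((1 + α) / 2) / Real.sqrt Real.pi / 2) := by
  obtain ⟨φ, hφ⟩ := exists_norm_sub_sq_eq_abs_rpow h0 (h1.trans one_lt_two)
  have hc := continuous_of_norm_sub_sq h0 hφ
  set A := Real.Gamma ((2 - α) / 2) * Real.Gamma ((1 + α) / 2) / Real.sqrt Real.pi with hA
  have hN := integral_cosh_rpow_sub_one h1
  set N := ∫ η : ℝ, Real.cosh η ^ (α - 1)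
  have hg1 := Real.Gamma_pos_of_pos (show 0 < (1 - α) / 2 by linarith)
  have hg2 := Real.Gamma_pos_of_pos (show 0 < (2 - α) / 2 by linarith)
  have hpi : 0 < Real.sqrt Real.pi := Real.sqrt_pos.2 Real.pi_pos
  have hN0 : 0 < N := by rw [hN]; positivity
  set w : ℝ → ℝ := fun θ => N⁻¹ * Real.cosh θ ^ (α - 1) with hw
  have hwi : Integrable w := (integrable_cosh_rpow_sub_one h1).const_mul _
  have hw1 : ∫ θ, w θ = 1 := by
    rw [hw, integral_const_mul]; exact inv_mul_cancel₀ hN0.ne'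
  obtain ⟨B, hB⟩ := (isCompact_Icc (a := (-1:ℝ)) (b := 1)).exists_bound_of_continuousOn
    hc.continuousOn
  have hbv := integral_weight_mul_norm_sub_sq (μ := volume) (ψ := fun θ => φ (Real.tanh θ)) hwi hw1
    (hc.comp continuous_tanh).aestronglyMeasurable
    (fun θ => hB _ ⟨(Real.neg_one_lt_tanh θ).le, (Real.tanh_lt_one θ).le⟩)
  set m := ∫ θ, w θ • φ (Real.tanh θ)
  set W := ∫ θ, w θ * ‖φ (Real.tanh θ) - m‖ ^ 2 with hW
  have hU : ∀ ξ, ‖φ (Real.tanh ξ) - m‖ ^ 2 = A - W := fun ξ => by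
    have h := hbv (φ (Real.tanh ξ))
    simp only [hφ, hw, mul_assoc] at h
    rw [integral_const_mul, integral_cosh_rpow_mul_abs_tanh_sub h0 h1,
      integral_abs_rpow_mul_inv_one_add_sq h0 h1, hN] at h
    have : A = (Real.sqrt Real.pi * Real.Gamma ((1 - α) / 2) / Real.Gamma ((2 - α) / 2))⁻¹ *
        (Real.Gamma ((1 + α) / 2) * Real.Gamma ((1 - α) / 2)) := by
      rw [hA]; field_simp
    rw [this]
    exact (sub_eq_of_eq_add h).symm
  have hWA : W = A / 2 := by
    have : W = A - W := by
      nth_rewrite 1 [hW]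
      simp only [hU]
      rw [integral_mul_const, hw1, one_mul]
    linarith
  have hIoo : ∀ x ∈ Ioo (-1 : ℝ) 1, ‖φ x - m‖ ^ 2 = A / 2 := fun x hx => by
    have := hU (Real.artanh x)
    rw [Real.tanh_artanh hx] at this
    linarith
  have hIcc : ∀ x ∈ Icc (-1 : ℝ) 1, ‖φ x - m‖ ^ 2 = A / 2 := by
    have hcl : IsClosed {x : ℝ | ‖φ x - m‖ ^ 2 = A / 2} :=
      isClosed_eq ((hc.sub continuous_const).norm.pow 2) continuous_const
    have := hcl.closure_subset_iff.2 (show Ioo (-1 : ℝ) 1 ⊆ _ from hIoo)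
    rwa [closure_Ioo (by norm_num)] at this
  refine ⟨fun x y => inner ℝ (φ x - m) (φ y - m), ?_, isPosSemidefKernelOn_inner _ _,
    fun x y => ?_, fun x hx => ?_⟩
  · exact ((hc.comp continuous_fst).sub continuous_const).inner
      ((hc.comp continuous_snd).sub continuous_const)
  · rw [inner_sub_variogram, hφ]
  · exact (real_inner_self_eq_norm_sq _).trans (hIcc x hx)

theorem integrable_norm_rpow_mul_exp_neg_norm_sq {E : Type*} [NormedAddCommGroup E]
    [NormedSpace ℝ E] [FiniteDimensional ℝ E] [Nontrivial E] [MeasurableSpace E] [BorelSpace E]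
    (μ : Measure E) [μ.IsAddHaarMeasure] {p : ℝ} (hp : 0 ≤ p) :
    Integrable (fun u : E => ‖u‖ ^ p * Real.exp (-‖u‖ ^ 2)) μ := by
  rw [integrable_fun_norm_addHaar μ (f := fun r => r ^ p * Real.exp (-r ^ 2))]
  have hn : 0 < Module.finrank ℝ E := Module.finrank_pos
  have := integrableOn_rpow_mul_exp_neg_mul_rpow (s := ((Module.finrank ℝ E - 1 : ℕ) : ℝ) + p)
    (p := 2) (b := 1) (by have : (0:ℝ) ≤ ((Module.finrank ℝ E - 1 : ℕ) : ℝ) := by positivity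
                          linarith) two_pos one_pos
  refine (integrableOn_congr_fun (fun r hr => ?_) measurableSet_Ioi).2 this
  have hr0 : (0:ℝ) < r := hr
  rw [smul_eq_mul, Real.rpow_add hr0, Real.rpow_natCast, Real.rpow_two, neg_one_mul]
  ring

theorem integral_norm_rpow_mul_exp_neg_norm_sq {E : Type*} [NormedAddCommGroup E]
    [NormedSpace ℝ E] [FiniteDimensional ℝ E] [Nontrivial E] [MeasurableSpace E] [BorelSpace E]
    (μ : Measure E) [μ.IsAddHaarMeasure] {p : ℝ} (hp : 0 ≤ p) :
    ∫ u, ‖u‖ ^ p * Real.exp (-‖u‖ ^ 2) ∂μ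
      = Module.finrank ℝ E * μ.real (Metric.ball 0 1)
        * (1 / 2 * Real.Gamma ((Module.finrank ℝ E + p) / 2)) := by
  have hn : 0 < Module.finrank ℝ E := Module.finrank_pos
  have hcast : ((Module.finrank ℝ E - 1 : ℕ) : ℝ) = (Module.finrank ℝ E : ℝ) - 1 := by
    rw [Nat.cast_sub hn, Nat.cast_one]
  rw [integral_fun_norm_addHaar μ (fun r => r ^ p * Real.exp (-r ^ 2))]
  have := integral_rpow_mul_exp_neg_rpow (p := 2) (q := ((Module.finrank ℝ E - 1 : ℕ) : ℝ) + p)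
    two_pos (by have : (0:ℝ) ≤ ((Module.finrank ℝ E - 1 : ℕ) : ℝ) := by positivity
                linarith)
  rw [show ((Module.finrank ℝ E - 1 : ℕ) : ℝ) + p + 1 = Module.finrank ℝ E + p by
    rw [hcast]; ring] at this
  rw [← this, nsmul_eq_mul, smul_eq_mul, ← mul_assoc]
  congr 1
  refine setIntegral_congr_fun measurableSet_Ioi fun r hr => ?_
  have hr0 : (0:ℝ) < r := hr
  simp only [smul_eq_mul]
  rw [Real.rpow_add hr0, Real.rpow_natCast, Real.rpow_two]
  ring

theorem integral_abs_rpow_mul_exp_neg_sq {α : ℝ} (h0 : 0 < α) :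
    ∫ t : ℝ, |t| ^ α * Real.exp (-t ^ 2) = Real.Gamma ((1 + α) / 2) := by
  have h := integral_comp_abs (f := fun t : ℝ => t ^ α * Real.exp (-t ^ 2))
  have := integral_rpow_mul_exp_neg_rpow (p := 2) (q := α) two_pos (by linarith)
  simp only [Real.rpow_two] at this
  simp only [sq_abs] at h
  rw [h, this, add_comm α 1]
  ring

theorem integral_abs_coord_rpow_mul_exp_neg_norm_sq {d : ℕ} (i : Fin d) {α : ℝ} (h0 : 0 < α) :
    (∫ u : EuclideanSpace ℝ (Fin d), |u i| ^ α * Real.exp (-‖u‖ ^ 2)) * Real.sqrt Real.pi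
      = Real.Gamma ((1 + α) / 2) * ∫ u : EuclideanSpace ℝ (Fin d), Real.exp (-‖u‖ ^ 2) := by
  have hgauss : ∫ t : ℝ, Real.exp (-t ^ 2) = Real.sqrt Real.pi := by
    simpa using integral_gaussian 1
  have hexp : ∀ x : Fin d → ℝ, Real.exp (-‖WithLp.toLp 2 x‖ ^ 2) = ∏ j, Real.exp (-x j ^ 2) := by
    intro x
    rw [EuclideanSpace.real_norm_sq_eq, ← Finset.sum_neg_distrib, Real.exp_sum]
  have hW : ∫ u : EuclideanSpace ℝ (Fin d), Real.exp (-‖u‖ ^ 2)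
      = ∏ _j : Fin d, Real.sqrt Real.pi := by
    rw [← (PiLp.volume_preserving_toLp (Fin d)).integral_comp
      (MeasurableEquiv.toLp 2 (Fin d → ℝ)).measurableEmbedding]
    simp only [hexp]
    rw [integral_fintype_prod_volume_eq_prod (fun _ t => Real.exp (-t ^ 2))]
    simp only [hgauss]
  have hM : ∫ u : EuclideanSpace ℝ (Fin d), |u i| ^ α * Real.exp (-‖u‖ ^ 2)
      = ∏ j : Fin d, if j = i then Real.Gamma ((1 + α) / 2) else Real.sqrt Real.pi := by
    rw [← (PiLp.volume_preserving_toLp (Fin d)).integral_comp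
      (MeasurableEquiv.toLp 2 (Fin d → ℝ)).measurableEmbedding]
    have hprod : ∀ x : Fin d → ℝ, |x i| ^ α * Real.exp (-‖WithLp.toLp 2 x‖ ^ 2)
        = ∏ j, (if j = i then |x j| ^ α * Real.exp (-x j ^ 2) else Real.exp (-x j ^ 2)) := by
      intro x
      rw [hexp, ← Finset.mul_prod_erase _ _ (Finset.mem_univ i),
        ← Finset.mul_prod_erase _ _ (Finset.mem_univ i), if_pos rfl, mul_assoc]
      congr 2
      exact Finset.prod_congr rfl fun j hj => by rw [if_neg (Finset.ne_of_mem_erase hj)]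
    simp only [hprod]
    rw [integral_fintype_prod_volume_eq_prod
      (fun j t => if j = i then |t| ^ α * Real.exp (-t ^ 2) else Real.exp (-t ^ 2))]
    refine Finset.prod_congr rfl fun j _ => ?_
    split_ifs
    · exact integral_abs_rpow_mul_exp_neg_sq h0
    · exact hgauss
  rw [hM, hW, ← Finset.mul_prod_erase _ _ (Finset.mem_univ i),
    ← Finset.mul_prod_erase _ (fun _ => Real.sqrt Real.pi) (Finset.mem_univ i), if_pos rfl,
    Finset.prod_congr rfl fun j hj => if_neg (Finset.ne_of_mem_erase hj)]
  ring

theorem integral_abs_inner_rpow_mul_exp_neg_norm_sq {d : ℕ} (i : Fin d) {α : ℝ}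
    (h : EuclideanSpace ℝ (Fin d)) :
    ∫ u, |inner ℝ h u| ^ α * Real.exp (-‖u‖ ^ 2)
      = ‖h‖ ^ α * ∫ u : EuclideanSpace ℝ (Fin d), |u i| ^ α * Real.exp (-‖u‖ ^ 2) := by
  set v : EuclideanSpace ℝ (Fin d) := ‖h‖ • EuclideanSpace.single i (1:ℝ) with hv
  have hnorm : ‖h‖ = ‖v‖ := by rw [hv, norm_smul]; simp
  set r := (Submodule.span ℝ {h - v})ᗮ.reflection
  have hr : r h = v := Submodule.reflection_sub hnorm
  have := r.measurePreserving.integral_comp' (f := r.toMeasurableEquiv)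
    (fun u => |inner ℝ v u| ^ α * Real.exp (-‖u‖ ^ 2))
  have hpt : ∀ u, |inner ℝ v u| ^ α * Real.exp (-‖u‖ ^ 2)
      = ‖h‖ ^ α * (|u i| ^ α * Real.exp (-‖u‖ ^ 2)) := fun u => by
    rw [hv, real_inner_smul_left, EuclideanSpace.inner_single_left, abs_mul,
      Real.mul_rpow (abs_nonneg _) (abs_nonneg _), abs_norm]
    simp [mul_assoc]
  rw [← integral_const_mul]
  simp only [← hpt]
  rw [← this]
  refine integral_congr_ae (ae_of_all _ fun u => ?_)
  show _ = |inner ℝ v (r u)| ^ α * Real.exp (-‖r u‖ ^ 2)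
  rw [← hr, r.inner_map_map, r.norm_map]

theorem IsPosSemidefKernelOn.integral_comp {X Ω : Type*} [MeasurableSpace Ω] {μ : Measure Ω}
    {S : Set X} {T : Type*} {C : T → T → ℝ} (hC : IsPosSemidefKernelOn univ C)
    {w : Ω → ℝ} (hw : ∀ ω, 0 ≤ w ω) (g : Ω → X → T)
    (hint : ∀ x ∈ S, ∀ y ∈ S, Integrable (fun ω => w ω * C (g ω x) (g ω y)) μ) :
    IsPosSemidefKernelOn S (fun x y => ∫ ω, w ω * C (g ω x) (g ω y) ∂μ) := by
  refine ⟨fun x _ y _ => ?_, fun n x hx c => ?_⟩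
  · simp only [hC.1 _ (mem_univ (g _ x)) _ (mem_univ (g _ y))]
  · have : ∑ i, ∑ j, c i * c j * ∫ ω, w ω * C (g ω (x i)) (g ω (x j)) ∂μ
        = ∫ ω, w ω * ∑ i, ∑ j, c i * c j * C (g ω (x i)) (g ω (x j)) ∂μ := by
      simp only [← integral_const_mul, Finset.mul_sum]
      rw [integral_finsetSum]
      · refine Finset.sum_congr rfl fun i _ => ?_
        rw [integral_finsetSum]
        · refine Finset.sum_congr rfl fun j _ => integral_congr_ae (ae_of_all _ fun ω => ?_)
          simp only; ring
        · intro j _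
          refine ((hint _ (hx i) _ (hx j)).const_mul (c i * c j)).congr (ae_of_all _ fun ω => ?_)
          simp only; ring
      · intro i _
        refine integrable_finsetSum _ fun j _ => ?_
        refine ((hint _ (hx i) _ (hx j)).const_mul (c i * c j)).congr (ae_of_all _ fun ω => ?_)
        simp only; ring
    rw [this]
    exact integral_nonneg fun ω => mul_nonneg (hw ω) (hC.2 n _ (fun _ => mem_univ _) c)

theorem IsPosSemidefKernelOn.const_mul {X : Type*} {S : Set X} {C : X → X → ℝ}
    (hC : IsPosSemidefKernelOn S C) {a : ℝ} (ha : 0 ≤ a) :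
    IsPosSemidefKernelOn S (fun x y => a * C x y) := by
  refine ⟨fun x hx y hy => by simp only [hC.1 x hx y hy], fun n x hx c => ?_⟩
  have : ∑ i, ∑ j, c i * c j * (a * C (x i) (x j))
      = a * ∑ i, ∑ j, c i * c j * C (x i) (x j) := by
    simp only [Finset.mul_sum]
    exact Finset.sum_congr rfl fun i _ => Finset.sum_congr rfl fun j _ => by ring
  rw [this]
  exact mul_nonneg ha (hC.2 n x hx c)

theorem IsPosSemidefKernelOn.sub_smul_anchor {X : Type*} {S : Set X} {C : X → X → ℝ}
    (hC : IsPosSemidefKernelOn S C) {z : X} (hz : z ∈ S) (ε : ℝ) :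
    IsPosSemidefKernelOn S
      (fun x y => C x y - ε * (C x z + C z y) + ε ^ 2 * C z z) := by
  refine ⟨fun x hx y hy => ?_, fun n x hx c => ?_⟩
  · simp only
    rw [hC.1 x hx y hy, hC.1 x hx z hz, hC.1 z hz y hy]; ring
  · have h := hC.2 (n + 1) (Fin.cons z x) (fun i => by
      refine Fin.cases ?_ (fun j => ?_) i
      · simpa using hz
      · simpa using hx j) (Fin.cons (-(ε * ∑ i, c i)) c)
    simp only [Fin.sum_univ_succ, Fin.cons_zero, Fin.cons_succ] at h
    convert h using 1
    have e1 : ∑ i, ∑ j, c i * c j * (C (x i) (x j) - ε * (C (x i) z + C z (x j)) + ε ^ 2 * C z z)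
        = ∑ i, ∑ j, c i * c j * C (x i) (x j)
          - ε * ((∑ i, c i * C (x i) z) * ∑ j, c j)
          - ε * ((∑ i, c i) * ∑ j, c j * C z (x j))
          + ε ^ 2 * C z z * ((∑ i, c i) * ∑ j, c j) := by
      rw [Finset.sum_mul_sum, Finset.sum_mul_sum, Finset.sum_mul_sum]
      simp only [Finset.mul_sum, ← Finset.sum_sub_distrib, ← Finset.sum_add_distrib]
      exact Finset.sum_congr rfl fun i _ => Finset.sum_congr rfl fun j _ => by ring
    have e2 (t : ℝ) : ∑ j, t * c j * C z (x j) = t * ∑ j, c j * C z (x j) := by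
      rw [Finset.mul_sum]; exact Finset.sum_congr rfl fun j _ => by ring
    have e3 (t : ℝ) : ∑ i, (c i * t * C (x i) z + ∑ j, c i * c j * C (x i) (x j))
        = t * ∑ i, c i * C (x i) z + ∑ i, ∑ j, c i * c j * C (x i) (x j) := by
      rw [Finset.sum_add_distrib, Finset.mul_sum]
      congr 1
      exact Finset.sum_congr rfl fun j _ => by ring
    rw [e1, e2, e3]
    ring

theorem exists_turning_bands_kernel {d : ℕ} (hd : 1 ≤ d) {α R v : ℝ} (h0 : 0 < α) (hR : 0 < R)
    {K : ℝ → ℝ → ℝ} (hcont : Continuous (Function.uncurry K)) (hK : IsPosSemidefKernelOn univ K)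
    (hvar : ∀ x y, K x x - 2 * K x y + K y y = |x - y| ^ α)
    (hv : ∀ x ∈ Icc (-1 : ℝ) 1, K x x ≤ v) :
    ∃ C : EuclideanSpace ℝ (Fin d) → EuclideanSpace ℝ (Fin d) → ℝ,
      IsPosSemidefKernelOn (Metric.closedBall 0 R) C ∧
      (∀ x ∈ Metric.closedBall (0 : EuclideanSpace ℝ (Fin d)) R,
        ∀ y ∈ Metric.closedBall (0 : EuclideanSpace ℝ (Fin d)) R,
        C x x - 2 * C x y + C y y = ‖x - y‖ ^ α) ∧
      (∀ x ∈ Metric.closedBall (0 : EuclideanSpace ℝ (Fin d)) R, C x x ≤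
        v * (Real.Gamma ((d + α) / 2) * Real.sqrt Real.pi /
          (Real.Gamma (d / 2) * Real.Gamma ((1 + α) / 2))) * R ^ α) ∧
      C 0 0 = K 0 0 * (Real.Gamma ((d + α) / 2) * Real.sqrt Real.pi /
          (Real.Gamma (d / 2) * Real.Gamma ((1 + α) / 2))) * R ^ α := by
  have hd0 : (0:ℝ) < d := by exact_mod_cast hd
  have : Nonempty (Fin d) := ⟨⟨0, hd⟩⟩
  let i : Fin d := ⟨0, hd⟩
  have hG := integral_norm_rpow_mul_exp_neg_norm_sq
    (volume : Measure (EuclideanSpace ℝ (Fin d))) h0.le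
  have hW := integral_norm_rpow_mul_exp_neg_norm_sq
    (volume : Measure (EuclideanSpace ℝ (Fin d))) le_rfl
  have hM := integral_abs_coord_rpow_mul_exp_neg_norm_sq i h0
  simp only [Real.rpow_zero, one_mul, add_zero, finrank_euclideanSpace_fin] at hG hW
  have hb : 0 < (volume : Measure (EuclideanSpace ℝ (Fin d))).real (Metric.ball 0 1) :=
    ENNReal.toReal_pos (Metric.measure_ball_pos _ _ one_pos).ne' measure_ball_lt_top.ne
  set b := (volume : Measure (EuclideanSpace ℝ (Fin d))).real (Metric.ball 0 1)
  set G := ∫ u : EuclideanSpace ℝ (Fin d), ‖u‖ ^ α * Real.exp (-‖u‖ ^ 2)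
  set W := ∫ u : EuclideanSpace ℝ (Fin d), Real.exp (-‖u‖ ^ 2)
  set M := ∫ u : EuclideanSpace ℝ (Fin d), |u i| ^ α * Real.exp (-‖u‖ ^ 2) with hMdef
  have g1 := Real.Gamma_pos_of_pos (show 0 < (d:ℝ) / 2 by positivity)
  have g2 := Real.Gamma_pos_of_pos (show 0 < (1 + α) / 2 by positivity)
  have g3 := Real.Gamma_pos_of_pos (show 0 < ((d:ℝ) + α) / 2 by positivity)
  have hpi : 0 < Real.sqrt Real.pi := Real.sqrt_pos.2 Real.pi_pos
  have hMeq : M = Real.Gamma ((1 + α) / 2) * W / Real.sqrt Real.pi := by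
    rw [eq_div_iff hpi.ne', hM]
  have hM0 : 0 < M := by rw [hMeq, hW]; positivity
  have hk : Real.Gamma ((d + α) / 2) * Real.sqrt Real.pi /
      (Real.Gamma (d / 2) * Real.Gamma ((1 + α) / 2)) = M⁻¹ * G := by
    rw [hMeq, hG, hW]; field_simp
  rw [hk]
  set w : EuclideanSpace ℝ (Fin d) → ℝ :=
    fun u => (R * ‖u‖) ^ α * Real.exp (-‖u‖ ^ 2) with hw
  have hweq : w = fun u => R ^ α * (‖u‖ ^ α * Real.exp (-‖u‖ ^ 2)) := by
    funext u
    rw [hw]; simp only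
    rw [Real.mul_rpow hR.le (norm_nonneg _), mul_assoc]
  have hw0 : ∀ u, 0 ≤ w u := fun u => by rw [hw]; positivity
  have hwi : Integrable w := by
    rw [hweq]
    exact (integrable_norm_rpow_mul_exp_neg_norm_sq volume h0.le).const_mul _
  have hwint : ∫ u, w u = R ^ α * G := by rw [hweq, integral_const_mul]
  set g : EuclideanSpace ℝ (Fin d) → EuclideanSpace ℝ (Fin d) → ℝ :=
    fun u x => inner ℝ x u / (R * ‖u‖) with hg
  have hgmem : ∀ x ∈ Metric.closedBall (0 : EuclideanSpace ℝ (Fin d)) R, ∀ u,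
      g u x ∈ Icc (-1 : ℝ) 1 := fun x hx u => by
    rw [mem_closedBall_zero_iff] at hx
    refine abs_le.1 ?_
    rw [hg]; simp only
    rw [abs_div, abs_of_nonneg (show 0 ≤ R * ‖u‖ by positivity)]
    exact div_le_one_of_le₀ ((abs_real_inner_le_norm x u).trans
      (mul_le_mul_of_nonneg_right hx (norm_nonneg _))) (by positivity)
  obtain ⟨B, hB⟩ := ((isCompact_Icc (a := (-1:ℝ)) (b := 1)).prod
    (isCompact_Icc (a := (-1:ℝ)) (b := 1))).exists_bound_of_continuousOn hcont.continuousOn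
  have hgm : ∀ x, Measurable (fun u => g u x) := fun x => by
    rw [hg]; fun_prop
  have hint : ∀ x ∈ Metric.closedBall (0 : EuclideanSpace ℝ (Fin d)) R,
      ∀ y ∈ Metric.closedBall (0 : EuclideanSpace ℝ (Fin d)) R,
      Integrable (fun u => w u * K (g u x) (g u y)) := fun x hx y hy =>
    hwi.mul_bdd (c := B)
      (hcont.measurable.comp ((hgm x).prodMk (hgm y))).aestronglyMeasurable
      (ae_of_all _ fun u => hB (g u x, g u y) ⟨hgmem x hx u, hgmem y hy u⟩)
  refine ⟨fun x y => M⁻¹ * ∫ u, w u * K (g u x) (g u y),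
    (hK.integral_comp hw0 g hint).const_mul (inv_pos.2 hM0).le, fun x hx y hy => ?_,
    fun x hx => ?_, ?_⟩
  · have : M⁻¹ * (∫ u, w u * K (g u x) (g u x)) - 2 * (M⁻¹ * ∫ u, w u * K (g u x) (g u y))
        + M⁻¹ * (∫ u, w u * K (g u y) (g u y))
        = M⁻¹ * ∫ u, (w u * K (g u x) (g u x) - 2 * (w u * K (g u x) (g u y))
          + w u * K (g u y) (g u y)) := by
      have hsub : Integrable
          (fun u => w u * K (g u x) (g u x) - 2 * (w u * K (g u x) (g u y))) :=
        (hint x hx x hx).sub ((hint x hx y hy).const_mul 2)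
      rw [integral_add hsub (hint y hy y hy),
        integral_sub (hint x hx x hx) ((hint x hx y hy).const_mul 2), integral_const_mul]
      ring
    rw [this]
    have hpt : ∀ u, w u * K (g u x) (g u x) - 2 * (w u * K (g u x) (g u y))
          + w u * K (g u y) (g u y) = |inner ℝ (x - y) u| ^ α * Real.exp (-‖u‖ ^ 2) := fun u => by
      have h1 : w u * K (g u x) (g u x) - 2 * (w u * K (g u x) (g u y))
          + w u * K (g u y) (g u y) = w u * |g u x - g u y| ^ α := by rw [← hvar]; ring
      rw [h1]
      simp only [hw, hg]
      rw [← sub_div, ← inner_sub_left, abs_div, abs_of_nonneg (show 0 ≤ R * ‖u‖ by positivity)]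
      rcases eq_or_ne u 0 with rfl | hu
      · simp [Real.zero_rpow h0.ne']
      · have hu' : 0 < R * ‖u‖ := mul_pos hR (norm_pos_iff.2 hu)
        rw [Real.div_rpow (abs_nonneg _) hu'.le]
        have : (R * ‖u‖) ^ α ≠ 0 := by positivity
        field_simp
    simp only [hpt]
    rw [integral_abs_inner_rpow_mul_exp_neg_norm_sq i, ← hMdef]
    field_simp
  · have : ∫ u, w u * K (g u x) (g u x) ≤ ∫ u, w u * v :=
      integral_mono (hint x hx x hx) (hwi.mul_const v) fun u =>
        mul_le_mul_of_nonneg_left (hv _ (hgmem x hx u)) (hw0 u)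
    rw [integral_mul_const, hwint] at this
    calc M⁻¹ * _ ≤ M⁻¹ * _ := mul_le_mul_of_nonneg_left this (inv_pos.2 hM0).le
      _ = _ := by ring
  · have : ∀ u, g u 0 = 0 := fun u => by simp [hg]
    simp only [this]
    rw [integral_mul_const, hwint]
    ring

theorem two_rpow_mul_sqrt_pi_lt_Gamma_mul_Gamma {α : ℝ} (h1 : 1 < α) (h2 : α < 2) :
    2 ^ α / 2 * Real.sqrt Real.pi < Real.Gamma ((2 - α) / 2) * Real.Gamma ((1 + α) / 2) := by
  have dup := Real.Gamma_mul_Gamma_add_half ((2 - α) / 2)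
  rw [show (2 - α) / 2 + 1 / 2 = (3 - α) / 2 by ring, show 2 * ((2 - α) / 2) = 2 - α by ring,
    show 1 - (2 - α) = α - 1 by ring, Real.rpow_sub_one two_ne_zero] at dup
  have hlt := Gamma_mul_lt (a := 2 - α) (b := (1 + α) / 2) (c := (3 - α) / 2) (e := 1)
    (by linarith) (by linarith) (by linarith) (by ring)
  rw [Real.Gamma_one, mul_one] at hlt
  have hY := Real.Gamma_pos_of_pos (show 0 < (3 - α) / 2 by linarith)
  refine lt_of_mul_lt_mul_right ?_ hY.le
  calc 2 ^ α / 2 * Real.sqrt Real.pi * Real.Gamma ((3 - α) / 2)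
      < 2 ^ α / 2 * Real.sqrt Real.pi * (Real.Gamma (2 - α) * Real.Gamma ((1 + α) / 2)) :=
        mul_lt_mul_of_pos_left hlt (by positivity)
    _ = Real.Gamma ((2 - α) / 2) * Real.Gamma ((3 - α) / 2) * Real.Gamma ((1 + α) / 2) := by
        rw [dup]; ring
    _ = _ := by ring

theorem exists_kernel_of_anchored_endpoints {d : ℕ} (hd : 1 ≤ d) {α R : ℝ}
    (h1 : 1 < α) (h2 : α < 2) (hR : 0 < R) :
    ∃ (C : EuclideanSpace ℝ (Fin d) → EuclideanSpace ℝ (Fin d) → ℝ) (c : ℝ),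
      IsPosSemidefKernelOn (Metric.closedBall 0 R) C ∧
      (∀ x ∈ Metric.closedBall (0 : EuclideanSpace ℝ (Fin d)) R,
        ∀ y ∈ Metric.closedBall (0 : EuclideanSpace ℝ (Fin d)) R,
        C x x - 2 * C x y + C y y = ‖x - y‖ ^ α) ∧
      c < Real.Gamma ((2 - α) / 2) * Real.Gamma ((d + α) / 2) / Real.Gamma (d / 2) / 2 * R ^ α ∧
      ∀ x ∈ Metric.closedBall (0 : EuclideanSpace ℝ (Fin d)) R, C x x ≤ c := by
  obtain ⟨K, hcont, hK, hvar, hv, -⟩ := exists_kernel_anchored_at_endpoints h1.le h2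
  obtain ⟨C, hC, hCvar, hCv, -⟩ :=
    exists_turning_bands_kernel hd (by linarith) hR hcont hK hvar hv
  refine ⟨C, _, hC, hCvar, ?_, hCv⟩
  have hd0 : (0:ℝ) < d := by exact_mod_cast hd
  have g1 := Real.Gamma_pos_of_pos (show 0 < (d:ℝ) / 2 by positivity)
  have g2 := Real.Gamma_pos_of_pos (show 0 < (1 + α) / 2 by linarith)
  have g3 := Real.Gamma_pos_of_pos (show 0 < ((d:ℝ) + α) / 2 by linarith)
  have key := two_rpow_mul_sqrt_pi_lt_Gamma_mul_Gamma h1 h2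
  have hRα : 0 < R ^ α := Real.rpow_pos_of_pos hR α
  calc 2 ^ α / 4 * (Real.Gamma ((d + α) / 2) * Real.sqrt Real.pi /
          (Real.Gamma (d / 2) * Real.Gamma ((1 + α) / 2))) * R ^ α
      = 2 ^ α / 2 * Real.sqrt Real.pi * (Real.Gamma ((d + α) / 2) * R ^ α /
          (2 * Real.Gamma (d / 2) * Real.Gamma ((1 + α) / 2))) := by field_simp; ring
    _ < Real.Gamma ((2 - α) / 2) * Real.Gamma ((1 + α) / 2) *
          (Real.Gamma ((d + α) / 2) * R ^ α /
          (2 * Real.Gamma (d / 2) * Real.Gamma ((1 + α) / 2))) :=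
        mul_lt_mul_of_pos_right key (by positivity)
    _ = _ := by field_simp

/-- A kernel on `[-1, 1]` whose variance is largest at the origin, where it attains the
minimal variance of a stationary representation. -/
theorem exists_kernel_variance_le_stationary {α : ℝ} (h0 : 0 < α) (h1 : α ≤ 1) :
    ∃ K : ℝ → ℝ → ℝ, Continuous (Function.uncurry K) ∧ IsPosSemidefKernelOn univ K ∧
      (∀ x y, K x x - 2 * K x y + K y y = |x - y| ^ α) ∧
      (∀ x ∈ Icc (-1 : ℝ) 1,
        K x x ≤ Real.Gamma ((2 - α) / 2) * Real.Gamma ((1 + α) / 2) / Real.sqrt Real.pi / 2) ∧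
      K 0 0 = Real.Gamma ((2 - α) / 2) * Real.Gamma ((1 + α) / 2) / Real.sqrt Real.pi / 2 := by
  rcases h1.lt_or_eq with h1 | rfl
  · obtain ⟨K, hcont, hK, hvar, hv⟩ := exists_stationary_kernel h0 h1
    exact ⟨K, hcont, hK, hvar, fun x hx => (hv x hx).le, hv 0 (by simp)⟩
  · obtain ⟨K, hcont, hK, hvar, hv, hz⟩ :=
      exists_kernel_anchored_at_endpoints le_rfl (one_lt_two (α := ℝ))
    have hpi : 0 < Real.sqrt Real.pi := Real.sqrt_pos.2 Real.pi_pos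
    have : Real.Gamma ((2 - 1) / 2) * Real.Gamma ((1 + 1) / 2) / Real.sqrt Real.pi / 2 = 1 / 2 := by
      rw [show ((2:ℝ) - 1) / 2 = 1 / 2 by norm_num, show ((1:ℝ) + 1) / 2 = 1 by norm_num,
        Real.Gamma_one_half_eq, Real.Gamma_one, mul_one, div_self hpi.ne']
    rw [this]
    refine ⟨K, hcont, hK, hvar, fun x hx => (hv x hx).trans (by norm_num), ?_⟩
    rw [hz]; norm_num

theorem exists_kernel_of_variance_le_stationary {d : ℕ} (hd : 2 ≤ d) {α R : ℝ}
    (h0 : 0 < α) (h1 : α ≤ 1) (hR : 0 < R) :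
    ∃ (C : EuclideanSpace ℝ (Fin d) → EuclideanSpace ℝ (Fin d) → ℝ) (c : ℝ),
      IsPosSemidefKernelOn (Metric.closedBall 0 R) C ∧
      (∀ x ∈ Metric.closedBall (0 : EuclideanSpace ℝ (Fin d)) R,
        ∀ y ∈ Metric.closedBall (0 : EuclideanSpace ℝ (Fin d)) R,
        C x x - 2 * C x y + C y y = ‖x - y‖ ^ α) ∧
      c < Real.Gamma ((2 - α) / 2) * Real.Gamma ((d + α) / 2) / Real.Gamma (d / 2) / 2 * R ^ α ∧
      ∀ x ∈ Metric.closedBall (0 : EuclideanSpace ℝ (Fin d)) R, C x x ≤ c := by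
  obtain ⟨K, hcont, hK, hvar, hv, hz⟩ := exists_kernel_variance_le_stationary h0 h1
  obtain ⟨C, hC, hCvar, hCv, hC0⟩ :=
    exists_turning_bands_kernel (by lia : 1 ≤ d) h0 hR hcont hK hvar hv
  rw [hz] at hC0
  have hd2 : (2:ℝ) ≤ d := by exact_mod_cast hd
  have g1 := Real.Gamma_pos_of_pos (show 0 < (d:ℝ) / 2 by linarith)
  have g2 := Real.Gamma_pos_of_pos (show 0 < (1 + α) / 2 by linarith)
  have hpi : 0 < Real.sqrt Real.pi := Real.sqrt_pos.2 Real.pi_pos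
  have hRα : 0 < R ^ α := Real.rpow_pos_of_pos hR α
  have hA : 1 < Real.Gamma ((2 - α) / 2) * Real.Gamma ((d + α) / 2) / Real.Gamma (d / 2) := by
    have := Gamma_mul_lt (a := (2 - α) / 2) (b := (d + α) / 2) (c := d / 2) (e := 1)
      (by linarith) (by linarith) (by linarith) (by ring)
    rwa [Real.Gamma_one, mul_one, ← one_lt_div g1] at this
  have ha : Real.Gamma ((2 - α) / 2) * Real.Gamma ((1 + α) / 2) / Real.sqrt Real.pi / 2 *
      (Real.Gamma ((d + α) / 2) * Real.sqrt Real.pi /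
          (Real.Gamma (d / 2) * Real.Gamma ((1 + α) / 2))) * R ^ α
      = Real.Gamma ((2 - α) / 2) * Real.Gamma ((d + α) / 2) / Real.Gamma (d / 2) / 2 * R ^ α := by
    field_simp
  rw [ha] at hC0
  rw [ha] at hCv
  set a := Real.Gamma ((2 - α) / 2) * Real.Gamma ((d + α) / 2) / Real.Gamma (d / 2) / 2 * R ^ α
  have haR : R ^ α / 2 < a := by
    calc R ^ α / 2 = 1 / 2 * R ^ α := by ring
      _ < a := mul_lt_mul_of_pos_right (div_lt_div_of_pos_right hA two_pos) hRα
  have ha0 : 0 < a := by linarith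
  set ε := (a - R ^ α / 2) / a with hε
  have hεa : ε * a = a - R ^ α / 2 := by rw [hε]; field_simp
  have hε0 : 0 < ε := div_pos (by linarith) ha0
  have hε1 : ε ≤ 1 := by rw [hε, div_le_one ha0]; linarith
  have hmem : (0 : EuclideanSpace ℝ (Fin d)) ∈ Metric.closedBall 0 R :=
    Metric.mem_closedBall_self hR.le
  refine ⟨_, a - ε * (a - R ^ α / 2), hC.sub_smul_anchor hmem ε, fun x hx y hy => ?_, ?_,
    fun x hx => ?_⟩
  · rw [← hCvar x hx y hy]
    simp only [hC.1 0 hmem x hx, hC.1 0 hmem y hy]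
    ring
  · have : 0 < ε * (a - R ^ α / 2) := mul_pos hε0 (by linarith)
    linarith
  · have hx0 := hCvar x hx 0 hmem
    rw [sub_zero, hC0] at hx0
    have hxR : ‖x‖ ^ α ≤ R ^ α :=
      Real.rpow_le_rpow (norm_nonneg _) (mem_closedBall_zero_iff.1 hx) h0.le
    simp only [hC.1 0 hmem x hx, hC0]
    have h3 : (1 - ε) * C x x ≤ (1 - ε) * a :=
      mul_le_mul_of_nonneg_left (hCv x hx) (by linarith)
    have h4 : ε * ‖x‖ ^ α ≤ ε * R ^ α := mul_le_mul_of_nonneg_left hxR hε0.le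
    have h5 : ε ^ 2 * a = ε * (a - R ^ α / 2) := by rw [← hεa]; ring
    have h6 : ε * (C x 0 + C x 0) = ε * (C x x + a - ‖x‖ ^ α) := by
      congr 1; linarith
    rw [h5, h6]
    linarith

end KernelConstruction

theorem stmt_8 (d : ℕ) (hd : 1 ≤ d) (α s R : ℝ) (hα : 0 < α ∧ α < 2)
    (hs : 0 < s) (hR : 0 < R) (hcase : 2 ≤ d ∨ 1 < α) :
    ∃ (C : EuclideanSpace ℝ (Fin d) → EuclideanSpace ℝ (Fin d) → ℝ) (c : ℝ),
      (∀ x ∈ Metric.closedBall (0 : EuclideanSpace ℝ (Fin d)) R,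
        ∀ y ∈ Metric.closedBall (0 : EuclideanSpace ℝ (Fin d)) R, C x y = C y x) ∧
      (∀ (n : ℕ) (x : Fin n → EuclideanSpace ℝ (Fin d)),
        (∀ i, x i ∈ Metric.closedBall (0 : EuclideanSpace ℝ (Fin d)) R) →
        ∀ cc : Fin n → ℝ, 0 ≤ ∑ i, ∑ j, cc i * cc j * C (x i) (x j)) ∧
      (∀ x ∈ Metric.closedBall (0 : EuclideanSpace ℝ (Fin d)) R,
        ∀ y ∈ Metric.closedBall (0 : EuclideanSpace ℝ (Fin d)) R,
        C x x - 2 * C x y + C y y = (‖x - y‖ / s) ^ α) ∧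
      c < (Real.Gamma ((2 - α) / 2) * Real.Gamma ((d + α) / 2) / Real.Gamma (d / 2) / 2)
            * (R / s) ^ α ∧
      (∀ x ∈ Metric.closedBall (0 : EuclideanSpace ℝ (Fin d)) R, C x x ≤ c) := by
  obtain ⟨h0, h2⟩ := hα
  have hsα : 0 < (s ^ α)⁻¹ := inv_pos.2 (Real.rpow_pos_of_pos hs α)
  obtain ⟨C, c, hC, hvar, hc, hle⟩ : ∃ (C : EuclideanSpace ℝ (Fin d) → EuclideanSpace ℝ (Fin d) → ℝ)
      (c : ℝ), IsPosSemidefKernelOn (Metric.closedBall 0 R) C ∧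
      (∀ x ∈ Metric.closedBall (0 : EuclideanSpace ℝ (Fin d)) R,
        ∀ y ∈ Metric.closedBall (0 : EuclideanSpace ℝ (Fin d)) R,
        C x x - 2 * C x y + C y y = ‖x - y‖ ^ α) ∧
      c < Real.Gamma ((2 - α) / 2) * Real.Gamma ((d + α) / 2) / Real.Gamma (d / 2) / 2 * R ^ α ∧
      ∀ x ∈ Metric.closedBall (0 : EuclideanSpace ℝ (Fin d)) R, C x x ≤ c := by
    rcases lt_or_ge 1 α with h1 | h1
    · exact exists_kernel_of_anchored_endpoints hd h1 h2 hR
    · exact exists_kernel_of_variance_le_stationary (hcase.resolve_right h1.not_gt) h0 h1 hR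
  obtain ⟨hsymm, hpos⟩ := hC.const_mul hsα.le
  refine ⟨_, (s ^ α)⁻¹ * c, hsymm, hpos, fun x hx y hy => ?_, ?_,
    fun x hx => mul_le_mul_of_nonneg_left (hle x hx) hsα.le⟩
  · rw [Real.div_rpow (norm_nonneg _) hs.le, ← hvar x hx y hy]
    ring
  · rw [Real.div_rpow hR.le hs.le]
    calc (s ^ α)⁻¹ * c < (s ^ α)⁻¹ * _ := mul_lt_mul_of_pos_left hc hsα
      _ = _ := by ring
end

section
/- Let K be a nonempty compact metric space, (Ω, 𝔉, P) a probability space, and let W₁, W₂ : K × Ω → ℝ be two stochastic processes with continuous sample paths such that, for i = 1, 2, every finite linear combination Σ_{j=1}^n a_j Wᵢ(x_j, ·) with x_j ∈ K and a_j ∈ ℝ is a centered Gaussian random variable. Let σᵢ²(x) = E[Wᵢ(x)²] and assume σ²_{i,max} := sup_{x∈K} σᵢ²(x) < ∞ for i = 1, 2 and σ²_{1,max} < σ²_{2,max}. Then for every continuous function y : K → ℝ, the probabilities P(sup_{x∈K}(W₂(x) − σ₂²(x)/2 − y(x)) > u) are positive for every u ∈ ℝ, and lim_{u→∞} P(sup_{x∈K}(W₁(x)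 − σ₁²(x)/2 − y(x)) > u) / P(sup_{x∈K}(W₂(x) − σ₂²(x)/2 − y(x)) > u) = 0. -/
open MeasureTheory ProbabilityTheory Filter
open scoped ENNReal NNReal Topology Real

/-- **Fernique's theorem** with constants independent of the dimension and of the measure. -/
lemma exists_gaussian_norm_tail_bound :
    ∃ L : ℝ, 0 < L ∧ ∃ M : ℝ≥0∞, M ≠ ∞ ∧
      ∀ (n : ℕ) (μ : Measure (Fin n → ℝ)) [IsGaussian μ], μ[id] = 0 → ∀ a t : ℝ, 0 ≤ t →
        3 / 4 ≤ μ {x | ‖x‖ ≤ a} →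
        μ {x | t < ‖x‖} ≤ M * ENNReal.ofReal (Real.exp (-(L * a⁻¹ ^ 2 * t ^ 2))) := by
  have h34 : (3 / 4 : ℝ≥0∞) = ((3 / 4 : ℝ≥0) : ℝ≥0∞) := by
    rw [ENNReal.coe_div (by norm_num)]; rfl
  have h12 : (2⁻¹ : ℝ≥0∞) < 3 / 4 := by
    have : (2⁻¹ : ℝ≥0∞) = ((2⁻¹ : ℝ≥0) : ℝ≥0∞) := by
      rw [ENNReal.coe_inv (by norm_num)]; rfl
    rw [this, h34, ENNReal.coe_lt_coe, ← NNReal.coe_lt_coe]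
    push_cast
    norm_num
  have h1 : (3 / 4 : ℝ≥0∞) < 1 := by
    rw [h34, ← ENNReal.coe_one, ENNReal.coe_lt_coe, ← NNReal.coe_lt_coe]
    push_cast
    norm_num
  have hlog : 0 < Real.log ((3 / 4 : ℝ≥0∞) / (1 - 3 / 4)).toReal := by
    refine Real.log_pos ?_
    rw [h34, ← ENNReal.coe_one, ← ENNReal.coe_sub, ENNReal.toReal_div, ENNReal.coe_toReal,
      ENNReal.coe_toReal, NNReal.coe_sub]
    · push_cast
      norm_num
    · rw [← NNReal.coe_le_coe]
      push_cast
      norm_num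
  have hL := Fernique.logRatio_pos h12 h1
  refine ⟨Fernique.logRatio (3 / 4), hL, .ofReal (Real.exp (Fernique.logRatio (3 / 4))) +
    ∑' n, .ofReal (Real.exp (-2⁻¹ * Real.log ((3 / 4 : ℝ≥0∞) / (1 - 3 / 4)).toReal * 2 ^ n)),
    ?_, fun n μ _ hμ a t ht ha ↦ ?_⟩
  rotate_left
  · have hint := lintegral_exp_mul_sq_norm_le_of_map_rotation_eq_self
      (IsGaussian.map_rotation_eq_self hμ _) ha h12
    set l := Fernique.logRatio (3 / 4) * a⁻¹ ^ 2
    have hl : 0 ≤ l := by positivity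
    have hmarkov := mul_meas_ge_le_lintegral₀ (μ := μ)
      (f := fun x ↦ ENNReal.ofReal (Real.exp (l * ‖x‖ ^ 2))) (by fun_prop)
      (ENNReal.ofReal (Real.exp (l * t ^ 2)))
    have hsub : {x : Fin n → ℝ | t < ‖x‖} ⊆
        {x | ENNReal.ofReal (Real.exp (l * t ^ 2)) ≤ ENNReal.ofReal (Real.exp (l * ‖x‖ ^ 2))} := by
      intro x hx
      have hx : t < ‖x‖ := hx
      simp only [Set.mem_ofPred_eq]
      gcongr
    rw [Real.exp_neg, ENNReal.ofReal_inv_of_pos (Real.exp_pos _), ← div_eq_mul_inv,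
      ENNReal.le_div_iff_mul_le (by simp [Real.exp_pos]) (by simp), mul_comm]
    calc _ ≤ ENNReal.ofReal (Real.exp (l * t ^ 2)) * μ _ := by gcongr
      _ ≤ _ := hmarkov.trans hint
  · refine (ENNReal.add_lt_top.mpr ⟨ENNReal.ofReal_lt_top, ?_⟩).ne
    refine Summable.tsum_ofReal_lt_top <|
      Real.summable_exp_nat_mul_of_ge ?_ (fun i ↦ mod_cast (Nat.lt_pow_self (by simp)).le)
    linarith

/-- Fernique's tail bound for the supremum of a centered Gaussian sequence. -/
lemma exists_gaussian_sequence_tail_bound :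
    ∃ L : ℝ, 0 < L ∧ ∃ M : ℝ≥0∞, M ≠ ∞ ∧
      ∀ {Ω : Type*} [MeasurableSpace Ω] (P : Measure Ω) [IsProbabilityMeasure P]
        (X : ℕ → Ω → ℝ), IsGaussianProcess X P → (∀ n, P[X n] = 0) →
        ∀ a t : ℝ, 0 ≤ a → 0 ≤ t → 3 / 4 ≤ P {ω | ∀ n, |X n ω| ≤ a} →
        P {ω | ∃ n, t < |X n ω|} ≤ M * ENNReal.ofReal (Real.exp (-(L * a⁻¹ ^ 2 * t ^ 2))) := by
  obtain ⟨L, hL, M, hM, h⟩ := exists_gaussian_norm_tail_bound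
  refine ⟨L, hL, M, hM, fun {Ω} _ P _ X hX hX0 a t ha ht hP ↦ ?_⟩
  let Y : (n : ℕ) → Ω → Fin n → ℝ := fun n ω i ↦ X i ω
  have hYg (n : ℕ) : HasGaussianLaw (Y n) P := by
    let l : (Finset.range n → ℝ) →L[ℝ] Fin n → ℝ :=
      ContinuousLinearMap.pi fun i ↦ .proj ⟨i, Finset.mem_range.2 i.2⟩
    exact (hX.hasGaussianLaw (Finset.range n)).map l
  have hY (n : ℕ) : P {ω | t < ‖Y n ω‖} ≤
      M * ENNReal.ofReal (Real.exp (-(L * a⁻¹ ^ 2 * t ^ 2))) := by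
    have hg := (hYg n).isGaussian_map
    have hm := (hYg n).aemeasurable
    have h0 : (P.map (Y n))[id] = 0 := by
      rw [integral_map hm (by fun_prop)]
      ext i
      simp only [id_eq]
      rw [eval_integral]
      · exact hX0 i
      · exact fun j ↦ (hX.hasGaussianLaw_eval j).integrable
    have := h n (P.map (Y n)) h0 a t ht
    rw [Measure.map_apply_of_aemeasurable hm (measurableSet_le (by fun_prop) (by fun_prop)),
      Measure.map_apply_of_aemeasurable hm (measurableSet_lt (by fun_prop) (by fun_prop))] at this
    refine this (hP.trans (measure_mono fun ω hω ↦ ?_))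
    exact (pi_norm_le_iff_of_nonneg ha).2 fun i ↦ hω i
  have hU : {ω | ∃ n, t < |X n ω|} ⊆ ⋃ n, {ω | t < ‖Y n ω‖} := by
    rintro ω ⟨n, hn⟩
    refine Set.mem_iUnion.2 ⟨n + 1, hn.trans_le ?_⟩
    exact norm_le_pi_norm (Y (n + 1) ω) (Fin.last n)
  have hmono : Monotone fun n ↦ {ω | t < ‖Y n ω‖} := by
    intro n m hnm ω hω
    refine lt_of_lt_of_le (show t < ‖Y n ω‖ from hω) ?_
    refine (pi_norm_le_iff_of_nonneg (norm_nonneg _)).2 fun i ↦ ?_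
    exact norm_le_pi_norm (Y m ω) (Fin.castLE hnm i)
  refine (measure_mono hU).trans ?_
  rw [hmono.measure_iUnion]
  exact iSup_le hY

/-- A process whose finite linear combinations are all centered Gaussian is a Gaussian process. -/
lemma isGaussianProcess_of_linear_combination {T Ω : Type*} [MeasurableSpace Ω] {P : Measure Ω}
    {W : T → Ω → ℝ}
    (h : ∀ (n : ℕ) (x : Fin n → T) (a : Fin n → ℝ),
      ∃ v : ℝ≥0, P.map (fun ω ↦ ∑ j, a j * W (x j) ω) = gaussianReal 0 v) :
    IsGaussianProcess W P where
  hasGaussianLaw I := by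
    classical
    have hW (x : T) : AEMeasurable (W x) P := by
      obtain ⟨v, hv⟩ := h 1 (fun _ ↦ x) (fun _ ↦ 1)
      simp only [Finset.univ_unique, Finset.sum_singleton, one_mul] at hv
      exact aemeasurable_of_map_neZero (by rw [hv]; infer_instance)
    refine ⟨isGaussian_of_map_eq_gaussianReal fun L ↦ ?_⟩
    obtain ⟨v, hv⟩ := h I.card (fun j ↦ (I.equivFin.symm j : T))
      (fun j ↦ L (Pi.single (I.equivFin.symm j) 1))
    refine ⟨0, v, ?_⟩
    rw [← hv, AEMeasurable.map_map_of_aemeasurable (by fun_prop)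
      (aemeasurable_pi_lambda (fun ω ↦ I.restrict (W · ω)) fun i ↦ hW i)]
    congr 1
    ext ω
    rw [Equiv.sum_comp I.equivFin.symm
      (fun i : I ↦ L (Pi.single i 1) * W i ω), Function.comp_apply]
    rw [← ContinuousLinearMap.coe_coe, LinearMap.pi_apply_eq_sum_univ]
    refine Finset.sum_congr rfl fun i _ ↦ ?_
    simp [mul_comm]
    left
    congr 1
    ext j
    simp [Pi.single_apply, eq_comm]

/-- Upper tail bound for a real Gaussian variable of variance at most `c`. -/
lemma gaussianReal_Ici_le {v c : ℝ≥0} (hvc : v ≤ c) {t : ℝ} (ht : 0 ≤ t) :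
    gaussianReal 0 v (Set.Ici t) ≤ ENNReal.ofReal (Real.exp (-(t ^ 2 / (2 * c)))) := by
  have hsub : HasSubgaussianMGF id c (gaussianReal 0 v) := by
    refine ⟨fun s ↦ integrable_exp_mul_gaussianReal s, fun s ↦ ?_⟩
    rw [mgf_id_gaussianReal]
    have : (v : ℝ) ≤ c := hvc
    simp only [zero_mul, zero_add]
    gcongr
  have := hsub.measure_ge_le ht
  rw [← ENNReal.ofReal_toReal (measure_ne_top (gaussianReal 0 v) (Set.Ici t))]
  refine ENNReal.ofReal_le_ofReal ?_
  rw [neg_div] at this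
  exact this

/-- Lower tail bound for a real Gaussian variable. -/
lemma le_gaussianReal_Ioi {v : ℝ≥0} (hv : v ≠ 0) {t : ℝ} (ht : 0 ≤ t) :
    ENNReal.ofReal ((√(2 * π * v))⁻¹ * Real.exp (-((t + 1) ^ 2 / (2 * v)))) ≤
      gaussianReal 0 v (Set.Ioi t) := by
  calc _ = ∫⁻ x in Set.Ioc t (t + 1),
        ENNReal.ofReal ((√(2 * π * v))⁻¹ * Real.exp (-((t + 1) ^ 2 / (2 * v)))) := by simp
    _ ≤ ∫⁻ x in Set.Ioc t (t + 1), gaussianPDF 0 v x := by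
      refine setLIntegral_mono (by fun_prop) fun x hx ↦ ?_
      rw [gaussianPDF, gaussianPDFReal, sub_zero, neg_div]
      gcongr
      · linarith [hx.1]
      · exact hx.2
    _ = gaussianReal 0 v (Set.Ioc t (t + 1)) := (gaussianReal_apply _ hv _).symm
    _ ≤ _ := measure_mono Set.Ioc_subset_Ioi_self

/-- Over small distances, the oscillation of a continuous process is small with probability
close to one. -/
lemma exists_delta_oscillation_prob {K Ω : Type*} [MetricSpace K] [CompactSpace K]
    [MeasurableSpace Ω] (P : Measure Ω) [IsProbabilityMeasure P] {W : K → Ω → ℝ}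
    (hW : ∀ ω, Continuous fun x ↦ W x ω) {a : ℝ} (ha : 0 < a) {c : ℝ≥0∞} (hc : c < 1) :
    ∃ δ > 0, c ≤ P {ω | ∀ x y, dist x y < δ → |W x ω - W y ω| ≤ a} := by
  let A : ℕ → Set Ω := fun n ↦ {ω | ∀ x y, dist x y < 1 / ((n : ℝ) + 1) → |W x ω - W y ω| ≤ a}
  have hmono : Monotone A := fun n m hnm ω hω x y hxy ↦
    hω x y (hxy.trans_le (one_div_le_one_div_of_le (by positivity) (by gcongr)))
  have hU : ⋃ n, A n = Set.univ := by
    refine Set.eq_univ_of_forall fun ω ↦ Set.mem_iUnion.2 ?_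
    obtain ⟨δ, hδ, h⟩ := Metric.uniformContinuous_iff.1
      (CompactSpace.uniformContinuous_of_continuous (hW ω)) a ha
    obtain ⟨n, hn⟩ := exists_nat_one_div_lt hδ
    exact ⟨n, fun x y hxy ↦ (h (hxy.trans hn)).le⟩
  have hlim := tendsto_measure_iUnion_atTop (μ := P) hmono
  rw [hU, measure_univ] at hlim
  obtain ⟨n, hn⟩ := (hlim.eventually_const_lt hc).exists
  exact ⟨1 / ((n : ℝ) + 1), by positivity, hn.le⟩

/-- For every `s` larger than all the variances of a centered Gaussian process with continuous
paths on a compact space, the supremum of the process has a Gaussian upper tail of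
variance `s`. -/
lemma exists_gaussian_sup_tail_bound {K Ω : Type*} [MetricSpace K] [CompactSpace K] [Nonempty K]
    [MeasurableSpace Ω] (P : Measure Ω) [IsProbabilityMeasure P] {W : K → Ω → ℝ}
    (hcont : ∀ ω, Continuous fun x ↦ W x ω) (hW : IsGaussianProcess W P)
    {v : K → ℝ≥0} (hv : ∀ x, P.map (W x) = gaussianReal 0 (v x)) {m s : ℝ} (hm : 0 ≤ m)
    (hvm : ∀ x, v x ≤ m) (hms : m < s) :
    ∃ C : ℝ≥0∞, C ≠ ∞ ∧ ∀ t : ℝ, 0 ≤ t →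
      P {ω | ∃ x, t < W x ω} ≤ C * ENNReal.ofReal (Real.exp (-(t ^ 2 / (2 * s)))) := by
  obtain ⟨L, hL, M, hM, hF⟩ := exists_gaussian_sequence_tail_bound
  have hs : 0 < s := hm.trans_lt hms
  obtain ⟨k, hk0, hk1, hks⟩ : ∃ k : ℝ, 0 < k ∧ k < 1 ∧ m ≤ k ^ 2 * s := by
    have h0 : 0 < (m + s) / (2 * s) := by positivity
    refine ⟨√((m + s) / (2 * s)), Real.sqrt_pos.2 h0, ?_, ?_⟩
    · rw [Real.sqrt_lt' one_pos, div_lt_iff₀ (by positivity)]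
      linarith
    · rw [Real.sq_sqrt h0.le]
      field_simp
      linarith
  have hk : 0 < 1 - k := by linarith
  let a : ℝ := (1 - k) * √(2 * s * L)
  have ha : 0 < a := by positivity
  obtain ⟨δ, hδ, hosc⟩ := exists_delta_oscillation_prob P hcont ha
    (c := 3 / 4) (ENNReal.div_lt_of_lt_mul (by norm_num))
  let Q : Set (K × K) := {p | dist p.1 p.2 < δ}
  have hQ : Nonempty Q := ⟨⟨(Classical.arbitrary K, Classical.arbitrary K), by simpa [Q] using hδ⟩⟩
  let p : ℕ → Q := TopologicalSpace.denseSeq Q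
  let X : ℕ → Ω → ℝ := fun n ω ↦ W (p n).1.1 ω - W (p n).1.2 ω
  have hX : IsGaussianProcess X P := by
    classical
    refine hW.of_isGaussianProcess fun n ↦ ⟨{(p n).1.1, (p n).1.2},
      .proj ⟨(p n).1.1, by simp⟩ - .proj ⟨(p n).1.2, by simp⟩, fun ω ↦ ?_⟩
    simp [X]
  have hmean (x : K) : P[W x] = 0 := by
    have := integral_map (hW.aemeasurable x) (f := fun z : ℝ ↦ z) (by fun_prop)
    rw [← this, hv, integral_id_gaussianReal]
  have hX0 (n : ℕ) : P[X n] = 0 := by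
    simp only [X]
    rw [integral_sub (hW.hasGaussianLaw_eval _).integrable (hW.hasGaussianLaw_eval _).integrable,
      hmean, hmean, sub_zero]
  have hXa : 3 / 4 ≤ P {ω | ∀ n, |X n ω| ≤ a} :=
    hosc.trans (measure_mono fun ω hω n ↦ hω _ _ (p n).2)
  obtain ⟨F, -, hFf, hFc⟩ := finite_cover_balls_of_compact (isCompact_univ (X := K)) hδ
  refine ⟨hFf.toFinset.card + M, by finiteness, fun t ht ↦ ?_⟩
  have hsub : {ω | ∃ x, t < W x ω} ⊆
      (⋃ x ∈ hFf.toFinset, W x ⁻¹' Set.Ici (k * t)) ∪ {ω | ∃ n, (1 - k) * t < |X n ω|} := by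
    rintro ω ⟨x, hx⟩
    obtain ⟨z, hz, hxz⟩ := Set.mem_iUnion₂.1 (hFc (Set.mem_univ x))
    by_cases hzt : k * t ≤ W z ω
    · exact .inl (Set.mem_iUnion₂.2 ⟨z, hFf.mem_toFinset.2 hz, hzt⟩)
    refine .inr ?_
    have hlt : (1 - k) * t < |W x ω - W z ω| := by
      refine lt_of_lt_of_le ?_ (le_abs_self _)
      linarith
    have hopen : IsOpen {q : Q | (1 - k) * t < |W q.1.1 ω - W q.1.2 ω|} := by
      have h1 := (hcont ω).comp (continuous_fst.comp (continuous_subtype_val (p := (· ∈ Q))))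
      have h2 := (hcont ω).comp (continuous_snd.comp (continuous_subtype_val (p := (· ∈ Q))))
      exact isOpen_lt continuous_const (h1.sub h2).abs
    obtain ⟨q, hq, n, rfl⟩ := (TopologicalSpace.denseRange_denseSeq Q).inter_open_nonempty _ hopen
      ⟨⟨(x, z), hxz⟩, hlt⟩
    exact ⟨n, hq⟩
  have hball (x : K) : P (W x ⁻¹' Set.Ici (k * t)) ≤
      ENNReal.ofReal (Real.exp (-(t ^ 2 / (2 * s)))) := by
    rw [← Measure.map_apply_of_aemeasurable (hW.aemeasurable x) measurableSet_Ici, hv]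
    have hc : v x ≤ (k ^ 2 * s).toNNReal := by
      exact NNReal.le_toNNReal_of_coe_le ((hvm x).trans hks)
    refine (gaussianReal_Ici_le hc (by positivity)).trans_eq ?_
    rw [Real.coe_toNNReal _ (by positivity)]
    congr 3
    field_simp
  have hfern := hF P X hX hX0 a ((1 - k) * t) ha.le (by positivity) hXa
  have hexp : L * a⁻¹ ^ 2 * ((1 - k) * t) ^ 2 = t ^ 2 / (2 * s) := by
    simp only [a]
    rw [inv_pow, mul_pow, Real.sq_sqrt (by positivity)]
    field_simp
  rw [hexp] at hfern
  calc P {ω | ∃ x, t < W x ω} ≤ _ := measure_mono hsub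
    _ ≤ _ := measure_union_le _ _
    _ ≤ ∑ x ∈ hFf.toFinset, P (W x ⁻¹' Set.Ici (k * t)) + _ := by
      gcongr
      exact measure_biUnion_finset_le _ _
    _ ≤ ∑ x ∈ hFf.toFinset, ENNReal.ofReal (Real.exp (-(t ^ 2 / (2 * s)))) +
        M * ENNReal.ofReal (Real.exp (-(t ^ 2 / (2 * s)))) := by
      gcongr with x
      exact hball x
    _ = _ := by rw [Finset.sum_const, nsmul_eq_mul, ← add_mul]

lemma tendsto_exp_sub_sq_div_sub_sq {s v : ℝ} (hs : 0 < s) (hsv : s < v) (b c : ℝ) :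
    Tendsto (fun u : ℝ ↦ Real.exp (-((u - b) ^ 2 / (2 * s)) + (u + c) ^ 2 / (2 * v))) atTop
      (𝓝 0) := by
  refine Real.tendsto_exp_atBot.comp ?_
  have hv : 0 < v := hs.trans hsv
  let κ : ℝ := 1 / (2 * s) - 1 / (2 * v)
  have hκ : 0 < κ := sub_pos.2 (one_div_lt_one_div_of_lt (by positivity) (by linarith))
  have h1 : Tendsto (fun u : ℝ ↦ -(u * κ) + (b / s + c / v)) atTop atBot :=
    tendsto_atBot_add_const_right _ _
      (tendsto_neg_atTop_atBot.comp (tendsto_id.atTop_mul_const hκ))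
  have h2 := tendsto_atBot_add_const_right _ (-(b ^ 2 / (2 * s)) + c ^ 2 / (2 * v))
    (tendsto_id.atTop_mul_atBot₀ h1)
  refine h2.congr fun u ↦ ?_
  simp only [κ, id]
  field_simp
  ring

theorem stmt_9
    {K : Type*} [MetricSpace K] [CompactSpace K] [Nonempty K]
    {Ω : Type*} [MeasurableSpace Ω] (P : Measure Ω) [IsProbabilityMeasure P]
    (W₁ W₂ : K → Ω → ℝ)
    (hcont₁ : ∀ ω, Continuous fun x => W₁ x ω)
    (hcont₂ : ∀ ω, Continuous fun x => W₂ x ω)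
    (hgauss₁ : ∀ (n : ℕ) (x : Fin n → K) (a : Fin n → ℝ),
      ∃ v : NNReal, P.map (fun ω => ∑ j, a j * W₁ (x j) ω) = gaussianReal 0 v)
    (hgauss₂ : ∀ (n : ℕ) (x : Fin n → K) (a : Fin n → ℝ),
      ∃ v : NNReal, P.map (fun ω => ∑ j, a j * W₂ (x j) ω) = gaussianReal 0 v)
    (σsq₁ σsq₂ : K → ℝ)
    (hσ₁ : ∀ x, σsq₁ x = ∫ ω, (W₁ x ω) ^ 2 ∂P)
    (hσ₂ : ∀ x, σsq₂ x = ∫ ω, (W₂ x ω) ^ 2 ∂P)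
    (hb₁ : BddAbove (Set.range σsq₁)) (hb₂ : BddAbove (Set.range σsq₂))
    (hlt : (⨆ x, σsq₁ x) < ⨆ x, σsq₂ x)
    (y : K → ℝ) (hy : Continuous y) :
    (∀ u : ℝ, 0 < P {ω | u < ⨆ x, (W₂ x ω - σsq₂ x / 2 - y x)}) ∧
    Tendsto (fun u : ℝ =>
        (P {ω | u < ⨆ x, (W₁ x ω - σsq₁ x / 2 - y x)}).toReal /
        (P {ω | u < ⨆ x, (W₂ x ω - σsq₂ x / 2 - y x)}).toReal)
      atTop (nhds 0) := by
  have hvar {W : K → Ω → ℝ} {σsq : K → ℝ}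
      (h : ∀ (n : ℕ) (x : Fin n → K) (a : Fin n → ℝ),
        ∃ v : NNReal, P.map (fun ω => ∑ j, a j * W (x j) ω) = gaussianReal 0 v)
      (hσ : ∀ x, σsq x = ∫ ω, (W x ω) ^ 2 ∂P) (x : K) :
      ∃ v : ℝ≥0, P.map (W x) = gaussianReal 0 v ∧ σsq x = v := by
    obtain ⟨v, hv⟩ := h 1 (fun _ ↦ x) (fun _ ↦ 1)
    simp only [Finset.univ_unique, Finset.sum_singleton, one_mul] at hv
    refine ⟨v, hv, ?_⟩
    have hm : AEMeasurable (W x) P :=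
      aemeasurable_of_map_neZero (by rw [hv]; infer_instance)
    rw [hσ, ← integral_map hm (f := fun z : ℝ ↦ z ^ 2) (by fun_prop), hv,
      ← variance_of_integral_eq_zero (X := fun z : ℝ ↦ z) (by fun_prop) integral_id_gaussianReal,
      variance_fun_id_gaussianReal]
  choose v₁ hv₁ hσv₁ using hvar hgauss₁ hσ₁
  choose v₂ hv₂ hσv₂ using hvar hgauss₂ hσ₂
  obtain ⟨B, hB⟩ : ∃ B, ∀ x, |y x| ≤ B := by
    obtain ⟨B, hB⟩ := isCompact_univ.exists_bound_of_continuousOn hy.continuousOn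
    exact ⟨B, fun x ↦ hB x (Set.mem_univ x)⟩
  obtain ⟨x₀, hx₀⟩ := exists_lt_of_lt_ciSup hlt
  have hmle (x : K) : (v₁ x : ℝ) ≤ ⨆ x, σsq₁ x := by
    rw [← hσv₁]
    exact le_ciSup hb₁ x
  have hm0 : 0 ≤ ⨆ x, σsq₁ x := (v₁ (Classical.arbitrary K)).2.trans (hmle _)
  rw [hσv₂] at hx₀
  obtain ⟨s, hms, hsv⟩ := exists_between hx₀
  have hs : 0 < s := hm0.trans_lt hms
  have hv0 : v₂ x₀ ≠ 0 := by
    rw [← NNReal.coe_ne_zero]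
    exact (hs.trans hsv).ne'
  let c : ℝ := v₂ x₀ / 2 + B
  have hB0 : 0 ≤ B := (abs_nonneg _).trans (hB x₀)
  have hc : 0 ≤ c := by positivity
  have hlower (u : ℝ) (hu : 0 ≤ u) :
      ENNReal.ofReal ((√(2 * π * v₂ x₀))⁻¹ * Real.exp (-((u + c + 1) ^ 2 / (2 * v₂ x₀)))) ≤
        P {ω | u < ⨆ x, (W₂ x ω - σsq₂ x / 2 - y x)} := by
    refine (le_gaussianReal_Ioi hv0 (add_nonneg hu hc)).trans ?_
    rw [← hv₂, Measure.map_apply_of_aemeasurable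
      ((isGaussianProcess_of_linear_combination hgauss₂).aemeasurable x₀) measurableSet_Ioi]
    refine measure_mono fun ω hω ↦ ?_
    have hω : u + c < W₂ x₀ ω := hω
    have hbdd : BddAbove (Set.range fun x ↦ W₂ x ω - σsq₂ x / 2 - y x) := by
      obtain ⟨D, hD⟩ := (isCompact_range (hcont₂ ω)).bddAbove
      refine ⟨D + B, ?_⟩
      rintro _ ⟨x, rfl⟩
      have h1 : W₂ x ω ≤ D := hD ⟨x, rfl⟩
      have h2 := (abs_le.1 (hB x)).1
      have h3 : 0 ≤ σsq₂ x := by rw [hσv₂]; exact (v₂ x).2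
      simp only
      linarith
    refine lt_of_lt_of_le ?_ (le_ciSup hbdd x₀)
    have h2 := (abs_le.1 (hB x₀)).2
    simp only [hσv₂, c] at hω ⊢
    linarith
  have hpos (u : ℝ) : 0 < P {ω | u < ⨆ x, (W₂ x ω - σsq₂ x / 2 - y x)} := by
    refine lt_of_lt_of_le ?_ ((hlower (max u 0) (le_max_right _ _)).trans
      (measure_mono fun ω hω ↦ (le_max_left u 0).trans_lt hω))
    have : (0 : ℝ) < v₂ x₀ := hs.trans hsv
    exact ENNReal.ofReal_pos.2 (by positivity)
  refine ⟨hpos, ?_⟩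
  obtain ⟨C, hC, hupper⟩ := exists_gaussian_sup_tail_bound P hcont₁
    (isGaussianProcess_of_linear_combination hgauss₁) hv₁ hm0 hmle hms
  have hup (u : ℝ) (hu : B ≤ u) :
      P {ω | u < ⨆ x, (W₁ x ω - σsq₁ x / 2 - y x)} ≤
        C * ENNReal.ofReal (Real.exp (-((u - B) ^ 2 / (2 * s)))) := by
    refine (measure_mono fun ω hω ↦ ?_).trans (hupper (u - B) (by linarith))
    have hω : u < ⨆ x, (W₁ x ω - σsq₁ x / 2 - y x) := hω
    obtain ⟨x, hx⟩ := exists_lt_of_lt_ciSup hω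
    refine ⟨x, ?_⟩
    have h2 := (abs_le.1 (hB x)).1
    have h3 : 0 ≤ σsq₁ x := by rw [hσv₁]; exact (v₁ x).2
    linarith
  have hlim := (tendsto_exp_sub_sq_div_sub_sq hs hsv B (c + 1)).const_mul
    (C.toReal * √(2 * π * v₂ x₀))
  rw [mul_zero] at hlim
  refine tendsto_of_tendsto_of_tendsto_of_le_of_le' tendsto_const_nhds hlim
    (.of_forall fun u ↦ by positivity) ?_
  filter_upwards [eventually_ge_atTop B] with u hu
  have hv0' : (0 : ℝ) < v₂ x₀ := hs.trans hsv
  have h1 := ENNReal.toReal_mono (by finiteness) (hup u hu)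
  have h2 := ENNReal.toReal_mono (by finiteness) (hlower u (hB0.trans hu))
  rw [ENNReal.toReal_mul, ENNReal.toReal_ofReal (Real.exp_nonneg _)] at h1
  rw [ENNReal.toReal_ofReal (by positivity)] at h2
  refine (div_le_div₀ (by positivity) h1 (by positivity) h2).trans_eq ?_
  rw [Real.exp_add, Real.exp_neg ((u + c + 1) ^ 2 / _), add_assoc u c 1]
  field_simp
end
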